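/- arXiv:1208.0813 — 4 statements merged into one kernel-verified Lean document; each statement's English description precedes it below -/
import Mathlib

section
/- For every integer n ≥ 1 and every integer m ≥ 2n−1, there exist n full finite words π_1,…,π_n over the alphabet {1,…,m} that constitute a winning strategy for the MC(n,m) game, i.e., there is no infinite run of immediate-scheduler steps from any initial configuration. -/
/-- A step of the immediate scheduler in the cyclically-traversed Musical Chairs game:
a nonempty set `S` of players, each in conflict (sharing a chair with another player),
advances one position (cyclically); everyone else stays put. -/
def MCStep {n m : ℕ} (π : Fin n → List (Fin m))
    (c c' : ∀ i, Fin (π i).length) : Prop :=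
  ∃ S : Finset (Fin n), S.Nonempty ∧
    (∀ i ∈ S, ∃ j, j ≠ i ∧ (π j).get (c j) = (π i).get (c i)) ∧
    (∀ i ∈ S, ((c' i : ℕ) = ((c i : ℕ) + 1) % (π i).length)) ∧
    (∀ i ∉ S, c' i = c i)

/-- The words constitute a winning strategy: there is no infinite run of steps
(from any initial configuration). -/
def MCWinning {n m : ℕ} (π : Fin n → List (Fin m)) : Prop :=
  ¬ ∃ f : ℕ → (∀ i, Fin (π i).length), ∀ t, MCStep π (f t) (f (t + 1))

/-- A word over the alphabet `Fin m` is full if every letter occurs in it. -/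
def MCFull {m : ℕ} (l : List (Fin m)) : Prop := ∀ a : Fin m, a ∈ l

namespace MC

variable {n m : ℕ}

/-- A state: the future of every player as an infinite sequence of chairs. -/
abbrev St (n m : ℕ) := Fin n → ℕ → Fin m

/-- The players in `S ⊆ Q` are kicked; chairs in `B` are broken (always in conflict). -/
def Step (Q : Finset (Fin n)) (B : Finset (Fin m)) (S : Finset (Fin n)) (h h' : St n m) : Prop :=
  S.Nonempty ∧ S ⊆ Q ∧
  (∀ i ∈ S, h i 0 ∈ B ∨ ∃ j ∈ Q, j ≠ i ∧ h j 0 = h i 0) ∧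
  (∀ i ∈ S, h' i = fun t => h i (t + 1)) ∧ (∀ i ∉ S, h' i = h i)

def Orb (w : ℕ → Fin m) : Set (ℕ → Fin m) := {h | ∃ a, h = fun t => w (a + t)}

abbrev Fam (n m : ℕ) := Fin n → Finset (Fin m) → ℕ → Fin m

/-- No infinite run. -/
def Term (W : Fam n m) (Q : Finset (Fin n)) (D : Fin n → Finset (Fin m)) (B : Finset (Fin m)) :
    Prop :=
  ∀ (f : ℕ → St n m) (S : ℕ → Finset (Fin n)), (∀ i ∈ Q, f 0 i ∈ Orb (W i (D i))) →
    (∀ t, Step Q B (S t) (f t) (f (t + 1))) → False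

def Per (W : Fam n m) (L : ℕ) : Prop := 0 < L ∧ ∀ i D t, W i D (t + L) = W i D t

def Good (W : Fam n m) : Prop :=
  (∃ L, Per W L) ∧ (∀ i D, D.Nonempty → ∀ t, W i D t ∈ D) ∧ (∀ i D, ∀ e ∈ D, ∃ t, W i D t = e)

theorem Step.orb {Q : Finset (Fin n)} {B : Finset (Fin m)} {S : Finset (Fin n)} {h h' : St n m}
    (hs : Step Q B S h h') {i : Fin n} {w : ℕ → Fin m} (ho : h i ∈ Orb w) : h' i ∈ Orb w := by
  obtain ⟨_, _, _, h4, h5⟩ := hs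
  by_cases hi : i ∈ S
  · obtain ⟨a, ha⟩ := ho
    refine ⟨a + 1, ?_⟩
    rw [h4 i hi, ha]
    funext t
    simp only
    congr 1
    omega
  · rw [h5 i hi]; exact ho

theorem per_mul {W : Fam n m} {L : ℕ} (hP : Per W L) (i D t k) : W i D (t + L * k) = W i D t := by
  induction k with
  | zero => simp
  | succ k ih => rw [Nat.mul_succ, ← Nat.add_assoc, hP.2, ih]

theorem per_mod {W : Fam n m} {L : ℕ} (hP : Per W L) (i D t) : W i D (t % L) = W i D t := by
  conv_rhs => rw [← Nat.mod_add_div t L]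
  rw [per_mul hP]

theorem Per.mul {W : Fam n m} {L k : ℕ} (hP : Per W L) (hk : 0 < k) : Per W (L * k) :=
  ⟨Nat.mul_pos hP.1 hk, fun i D t => per_mul hP i D t k⟩

/-- Termination gives a uniform bound. -/
theorem bound {W : Fam n m} {L : ℕ} (hP : Per W L) {Q : Finset (Fin n)}
    {D : Fin n → Finset (Fin m)} {B : Finset (Fin m)} (hT : Term W Q D B)
    (f : ℕ → St n m) (S : ℕ → Finset (Fin n)) (h0 : ∀ i ∈ Q, f 0 i ∈ Orb (W i (D i)))
    (hs : ∀ t < L ^ n, Step Q B (S t) (f t) (f (t + 1))) : False := by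
  have horb : ∀ t ≤ L ^ n, ∀ i ∈ Q, f t i ∈ Orb (W i (D i)) := by
    intro t
    induction t with
    | zero => intro _; exact h0
    | succ t ih => intro ht i hi; exact (hs t (by omega)).orb (ih (by omega) i hi)
  have hout : ∀ t ≤ L ^ n, ∀ i ∉ Q, f t i = f 0 i := by
    intro t
    induction t with
    | zero => intro _ i _; rfl
    | succ t ih =>
      intro ht i hi
      obtain ⟨_, hq, _, _, h5⟩ := hs t (by omega)
      rw [h5 i (fun h => hi (hq h)), ih (by omega) i hi]
  have hcode : ∀ t ≤ L ^ n, ∃ a : Fin n → Fin L, ∀ i ∈ Q,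
      f t i = fun x => W i (D i) ((a i : ℕ) + x) := by
    intro t ht
    have : ∀ i, ∃ a : Fin L, i ∈ Q → f t i = fun x => W i (D i) ((a : ℕ) + x) := by
      intro i
      by_cases hi : i ∈ Q
      · obtain ⟨a, ha⟩ := horb t ht i hi
        refine ⟨⟨a % L, Nat.mod_lt _ hP.1⟩, fun _ => ?_⟩
        rw [ha]
        funext x
        simp only
        rw [← per_mod hP, ← per_mod hP i (D i) (a % L + x)]
        simp
      · exact ⟨⟨0, hP.1⟩, fun h => absurd h hi⟩
    choose a ha using this
    exact ⟨a, fun i hi => ha i hi⟩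
  choose code hc using hcode
  obtain ⟨x, y, hxy, he⟩ := Fintype.exists_ne_map_eq_of_card_lt
    (fun t : Fin (L ^ n + 1) => code t (by omega)) (by simp)
  wlog hlt : x < y generalizing x y
  · exact this y x hxy.symm he.symm (lt_of_le_of_ne (not_lt.mp hlt) hxy.symm)
  have hfe : f x = f y := by
    funext i
    by_cases hi : i ∈ Q
    · rw [hc x (by omega) i hi, hc y (by omega) i hi]
      have he' : code x (by omega) = code y (by omega) := he
      rw [he']
    · rw [hout x (by omega) i hi, hout y (by omega) i hi]
  have hlt' : (x : ℕ) < y := hlt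
  have hy := y.2
  obtain ⟨d, hd⟩ : ∃ d, (y : ℕ) = x + d := ⟨y - x, by omega⟩
  have hd0 : 0 < d := by omega
  refine hT (fun t => f (x + t % d)) (fun t => S (x + t % d)) ?_ ?_
  · intro i hi
    simpa using horb x (by omega) i hi
  · intro t
    have hm := Nat.mod_lt t hd0
    have h1 := hs (x + t % d) (by omega)
    rcases Nat.lt_or_ge (t % d + 1) d with h | h
    · have : (t + 1) % d = t % d + 1 := by
        rw [Nat.add_mod, ← Nat.mod_eq_of_lt h]; simp
      simp only [this]
      exact h1
    · have h2 : t % d + 1 = d := by omega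
      have : (t + 1) % d = 0 := by
        rw [← Nat.mod_add_mod, h2, Nat.mod_self]
      simp only [this]
      rw [Nat.add_assoc, h2, ← hd, ← hfe] at h1
      exact h1

theorem Step.congr {Q : Finset (Fin n)} {B : Finset (Fin m)} {S : Finset (Fin n)} {h h' k : St n m}
    (hs : Step Q B S h h') {T : ℕ} (hk : ∀ i, ∀ t < T + 1, h i t = k i t) :
    Step Q B S k (fun i => if i ∈ S then fun t => k i (t + 1) else k i) ∧
    ∀ i, ∀ t < T, h' i t = (if i ∈ S then fun t => k i (t + 1) else k i) t := by
  obtain ⟨h1, h2, h3, h4, h5⟩ := hs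
  refine ⟨⟨h1, h2, ?_, ?_, ?_⟩, ?_⟩
  · intro i hi
    have := h3 i hi
    simp only [hk _ 0 (Nat.succ_pos T)] at this
    exact this
  · intro i hi; simp [hi]
  · intro i hi; simp [hi]
  · intro i t ht
    by_cases hi : i ∈ S
    · simp only [hi, if_true]; rw [h4 i hi]; exact hk i _ (by omega)
    · simp only [hi, if_false]; rw [h5 i hi]; exact hk i _ (by omega)

theorem run_congr {Q : Finset (Fin n)} {B : Finset (Fin m)} (T : ℕ) (f : ℕ → St n m)
    (S : ℕ → Finset (Fin n)) (hs : ∀ t < T, Step Q B (S t) (f t) (f (t + 1))) (k : St n m)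
    (hk : ∀ i, ∀ t < T, f 0 i t = k i t) :
    ∃ g : ℕ → St n m, g 0 = k ∧ ∀ t < T, Step Q B (S t) (g t) (g (t + 1)) := by
  induction T generalizing f S k with
  | zero => exact ⟨fun _ => k, rfl, by simp⟩
  | succ T ih =>
    obtain ⟨h1, h2⟩ := (hs 0 (by omega)).congr hk
    obtain ⟨g, hg0, hg⟩ := ih (fun t => f (t + 1)) (fun t => S (t + 1))
      (fun t ht => hs (t + 1) (by omega)) _ h2
    refine ⟨fun t => Nat.casesOn t k g, rfl, ?_⟩
    intro t ht
    cases t with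
    | zero => simpa [hg0] using h1
    | succ t => exact hg t (by omega)

/-- If halting `i` always leads to termination, then `i` is kicked cofinally. -/
theorem cofinal {W : Fam n m} (hW : Good W) {Q : Finset (Fin n)}
    {D : Fin n → Finset (Fin m)} {B : Finset (Fin m)} {i : Fin n} (hi : i ∈ Q)
    (hDi : (D i).Nonempty)
    (hT : ∀ c ∈ D i, Term W (Q.erase i) D (insert c B))
    (f : ℕ → St n m) (S : ℕ → Finset (Fin n)) (h0 : ∀ i ∈ Q, f 0 i ∈ Orb (W i (D i)))
    (hs : ∀ t, Step Q B (S t) (f t) (f (t + 1))) (t0 : ℕ) : ∃ t ≥ t0, i ∈ S t := by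
  by_contra hcon
  push Not at hcon
  have horb : ∀ t, ∀ i ∈ Q, f t i ∈ Orb (W i (D i)) := by
    intro t
    induction t with
    | zero => exact h0
    | succ t ih => intro i hi; exact (hs t).orb (ih i hi)
  have hst : ∀ t, f (t0 + t) i = f t0 i := by
    intro t
    induction t with
    | zero => rfl
    | succ t ih =>
      rw [← ih]
      exact (hs (t0 + t)).2.2.2.2 i (hcon _ (by omega))
  have hc : f t0 i 0 ∈ D i := by
    obtain ⟨a, ha⟩ := horb t0 i hi
    rw [ha]
    exact hW.2.1 i _ hDi _
  refine hT _ hc (fun t => f (t0 + t)) (fun t => S (t0 + t))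
    (fun j hj => horb t0 j (Finset.mem_of_mem_erase hj)) ?_
  intro t
  obtain ⟨h1, h2, h3, h4, h5⟩ := hs (t0 + t)
  have hn : i ∉ S (t0 + t) := hcon _ (by omega)
  refine ⟨h1, fun j hj => Finset.mem_erase.2 ⟨fun h => hn (h ▸ hj), h2 hj⟩, ?_, h4, h5⟩
  intro j hj
  rcases h3 j hj with h | ⟨l, hl, hne, he⟩
  · exact Or.inl (Finset.mem_insert_of_mem h)
  · by_cases hli : l = i
    · left
      rw [← he, hli, hst]
      exact Finset.mem_insert_self _ _
    · exact Or.inr ⟨l, Finset.mem_erase.2 ⟨hli, hl⟩, hne, he⟩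

theorem reach {Q : Finset (Fin n)} {B : Finset (Fin m)} {i : Fin n}
    (f : ℕ → St n m) (S : ℕ → Finset (Fin n))
    (hs : ∀ t, Step Q B (S t) (f t) (f (t + 1))) (hc : ∀ t0, ∃ t ≥ t0, i ∈ S t) (N : ℕ) :
    ∃ t, f t i = fun x => f 0 i (N + x) := by
  induction N with
  | zero => exact ⟨0, by simp⟩
  | succ N ih =>
    obtain ⟨t, ht⟩ := ih
    have hex : ∃ d, i ∈ S (t + d) := by
      obtain ⟨t', h1, h2⟩ := hc t
      exact ⟨t' - t, by rwa [Nat.add_sub_cancel' h1]⟩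
    classical
    have hst : ∀ d ≤ Nat.find hex, f (t + d) i = f t i := by
      intro d
      induction d with
      | zero => intro _; rfl
      | succ d ih =>
        intro hd
        rw [← ih (by omega)]
        exact (hs (t + d)).2.2.2.2 i (Nat.find_min hex (by omega))
    refine ⟨t + Nat.find hex + 1, ?_⟩
    rw [(hs (t + Nat.find hex)).2.2.2.1 i (Nat.find_spec hex), hst _ le_rfl, ht]
    funext x
    simp only
    congr 1
    omega

theorem priv {W : Fam n m} (hW : Good W) {Q : Finset (Fin n)}
    {D : Fin n → Finset (Fin m)} {B : Finset (Fin m)} {i : Fin n} (hi : i ∈ Q)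
    {e : Fin m} (he : e ∈ D i) (heB : e ∉ B)
    (hpr : ∀ j ∈ Q, j ≠ i → (D j).Nonempty ∧ e ∉ D j)
    (hT : ∀ c ∈ D i, Term W (Q.erase i) D (insert c B)) : Term W Q D B := by
  intro f S h0 hs
  have hc := cofinal hW hi ⟨e, he⟩ hT f S h0 hs
  have horb : ∀ t, ∀ i ∈ Q, f t i ∈ Orb (W i (D i)) := by
    intro t
    induction t with
    | zero => exact h0
    | succ t ih => intro i hi; exact (hs t).orb (ih i hi)
  obtain ⟨L, hL⟩ := hW.1
  obtain ⟨a, ha⟩ := h0 i hi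
  obtain ⟨x, hx⟩ := hW.2.2 i (D i) e he
  have hLa : a ≤ L * a := Nat.le_mul_of_pos_left a hL.1
  obtain ⟨t, ht⟩ := reach f S hs hc (x + L * a - a)
  have hte : f t i 0 = e := by
    rw [ht, ha]
    simp only
    rw [← hx, ← per_mul hL i (D i) x a]
    congr 1
    omega
  have hno : ∀ t, f t i 0 = e → i ∉ S t := by
    intro t hte hiS
    rcases (hs t).2.2.1 i hiS with h | ⟨j, hj, hne, hje⟩
    · exact heB (hte ▸ h)
    · obtain ⟨hn, hnot⟩ := hpr j hj hne
      obtain ⟨b, hb⟩ := horb t j hj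
      apply hnot
      rw [← hte, ← hje, hb]
      exact hW.2.1 j _ hn _
  have hst : ∀ d, f (t + d) i 0 = e := by
    intro d
    induction d with
    | zero => exact hte
    | succ d ih =>
      have := (hs (t + d)).2.2.2.2 i (hno _ ih)
      rw [← Nat.add_assoc, this, ih]
  obtain ⟨t', h1, h2⟩ := hc t
  refine hno t' ?_ h2
  have := hst (t' - t)
  rwa [Nat.add_sub_cancel' h1] at this

/-- One refinement level for player `p`. -/
def Rel (p : Fin n) (W W' : Fam n m) : Prop :=
  (∀ i, i ≠ p → W' i = W i) ∧
  ∀ (Q : Finset (Fin n)) (D : Fin n → Finset (Fin m)) (B E : Finset (Fin m)), p ∈ Q →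
    E ⊆ D p → E.Nonempty → Term W Q (Function.update D p E) B →
    (∀ c ∈ D p, Term W (Q.erase p) D (insert c B)) → Term W' Q D B

theorem term_eq {W W' : Fam n m} {Q : Finset (Fin n)} {D D' : Fin n → Finset (Fin m)}
    {B : Finset (Fin m)} (h : ∀ i ∈ Q, W' i (D' i) = W i (D i)) (hT : Term W Q D B) :
    Term W' Q D' B := by
  intro f S h0 hs
  exact hT f S (fun i hi => by rw [← h i hi]; exact h0 i hi) hs

theorem exists_rel (p : Fin n) (W : Fam n m) (hW : Good W) : ∃ W', Good W' ∧ Rel p W W' := by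
  obtain ⟨L, hL⟩ := hW.1
  set R := L ^ n + 1 with hR
  have hR0 : 0 < R := by omega
  let K := Fintype.card (Finset (Fin m))
  have hK0 : 0 < K := Fintype.card_pos
  let ee : Finset (Fin m) ≃ Fin K := Fintype.equivFin _
  let sel : Finset (Fin m) → ℕ → Finset (Fin m) := fun D q =>
    let E := ee.symm ⟨q % K, Nat.mod_lt _ hK0⟩
    if E ⊆ D ∧ E.Nonempty then E else D
  let V : Finset (Fin m) → ℕ → Fin m := fun D t => W p (sel D (t / R)) (t % R)
  let W' : Fam n m := fun i => if i = p then V else W i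
  have hWp : W' p = V := by simp [W']
  have hWn : ∀ i, i ≠ p → W' i = W i := fun i hi => by simp [W', hi]
  have hselper : ∀ D q, sel D (q + K) = sel D q := by
    intro D q; simp [sel]
  have hV : ∀ D t, V D (t + R * K) = V D t := by
    intro D t
    simp only [V]
    rw [Nat.add_mul_div_left _ _ hR0, hselper, Nat.add_mul_mod_self_left]
  have hVk : ∀ D t k, V D (t + R * K * k) = V D t := by
    intro D t k
    induction k with
    | zero => simp
    | succ k ih => rw [Nat.mul_succ, ← Nat.add_assoc, hV, ih]
  have hselee : ∀ D E, E ⊆ D → E.Nonempty → sel D (ee E) = E := by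
    intro D E h1 h2
    have : (⟨(ee E : ℕ) % K, Nat.mod_lt _ hK0⟩ : Fin K) = ee E :=
      Fin.ext (Nat.mod_eq_of_lt (ee E).2)
    simp [sel, this, h1, h2]
  have hphase : ∀ D E, E ⊆ D → E.Nonempty → ∀ x < R, V D (R * (ee E : ℕ) + x) = W p E x := by
    intro D E h1 h2 x hx
    simp only [V]
    rw [Nat.mul_add_div hR0, Nat.div_eq_of_lt hx, Nat.add_zero, hselee D E h1 h2,
      Nat.mul_add_mod, Nat.mod_eq_of_lt hx]
  have hselne : ∀ D q, D.Nonempty → (sel D q).Nonempty ∧ sel D q ⊆ D := by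
    intro D q hD
    simp only [sel]
    split_ifs with h
    · exact ⟨h.2, h.1⟩
    · exact ⟨hD, Finset.Subset.refl _⟩
  have hG : Good W' := by
    refine ⟨⟨L * (R * K), Nat.mul_pos hL.1 (Nat.mul_pos hR0 hK0), ?_⟩, ?_, ?_⟩
    · intro i D t
      by_cases hi : i = p
      · subst hi
        rw [hWp, Nat.mul_comm, hVk]
      · rw [hWn i hi, per_mul hL]
    · intro i D hD t
      by_cases hi : i = p
      · subst hi
        rw [hWp]
        obtain ⟨h1, h2⟩ := hselne D (t / R) hD
        exact h2 (hW.2.1 i _ h1 _)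
      · rw [hWn i hi]; exact hW.2.1 i D hD t
    · intro i D e he
      by_cases hi : i = p
      · subst hi
        rw [hWp]
        refine ⟨R * (ee {e} : ℕ) + 0, ?_⟩
        rw [hphase D {e} (by simpa using he) (by simp) 0 hR0]
        simpa using hW.2.1 i {e} (by simp) 0
      · rw [hWn i hi]; exact hW.2.2 i D e he
  refine ⟨W', hG, hWn, ?_⟩
  intro Q D B E hp hE hEn hT hhalt f S h0 hs
  have hhalt' : ∀ c ∈ D p, Term W' (Q.erase p) D (insert c B) := by
    intro c hc
    refine term_eq (fun i hi => ?_) (hhalt c hc)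
    rw [hWn i (Finset.ne_of_mem_erase hi)]
  have hc := cofinal hG hp (hEn.mono hE) hhalt' f S h0 hs
  obtain ⟨a, ha⟩ := h0 p hp
  have hle : a ≤ R * K * a := Nat.le_mul_of_pos_left a (Nat.mul_pos hR0 hK0)
  obtain ⟨t1, ht1⟩ := reach f S hs hc (R * (ee E : ℕ) + R * K * a - a)
  have hfp : ∀ x < R, f t1 p x = W p E x := by
    intro x hx
    rw [ht1, ha]
    simp only
    rw [hWp, ← hphase (D p) E hE hEn x hx, ← hVk (D p) (R * (ee E : ℕ) + x) a]
    congr 1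
    generalize R * K * a = u at hle ⊢
    generalize R * (ee E : ℕ) = v
    omega
  have horb : ∀ t, ∀ i ∈ Q, f t i ∈ Orb (W' i (D i)) := by
    intro t
    induction t with
    | zero => exact h0
    | succ t ih => intro i hi; exact (hs t).orb (ih i hi)
  obtain ⟨g, hg0, hg⟩ := run_congr (L ^ n) (fun t => f (t1 + t)) (fun t => S (t1 + t))
    (fun t _ => hs (t1 + t)) (Function.update (f t1) p (W p E)) (by
      intro i t ht
      by_cases hi : i = p
      · subst hi
        simpa using hfp t (by omega)
      · simp [hi])
  refine bound hL hT g (fun t => S (t1 + t)) ?_ hg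
  intro i hi
  rw [hg0]
  by_cases hip : i = p
  · subst hip
    simp only [Function.update_self]
    exact ⟨0, by simp⟩
  · simp only [Function.update_of_ne hip]
    rw [← hWn i hip]
    exact horb t1 i hi

theorem exists_good (hm : 0 < m) : ∃ W : Fam n m, Good W := by
  refine ⟨fun _ D t => if (⟨t % m, Nat.mod_lt _ hm⟩ : Fin m) ∈ D then ⟨t % m, Nat.mod_lt _ hm⟩
    else if h : D.Nonempty then D.min' h else ⟨0, hm⟩, ⟨m, hm, ?_⟩, ?_, ?_⟩
  · intro i D t; simp
  · intro i D hD t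
    simp only
    split_ifs with h
    · exact h
    · exact D.min'_mem hD
  · intro i D e he
    refine ⟨e, ?_⟩
    have : (⟨(e : ℕ) % m, Nat.mod_lt _ hm⟩ : Fin m) = e := Fin.ext (Nat.mod_eq_of_lt e.2)
    simp [this, he]

theorem main (hn : 0 < n) (W : ℕ → Fam n m) (hG : ∀ s, Good (W s))
    (hR : ∀ s, Rel ⟨s % n, Nat.mod_lt _ hn⟩ (W s) (W (s + 1))) (k : ℕ) :
    ∀ s ≥ k * n, ∀ (Q : Finset (Fin n)) (D : Fin n → Finset (Fin m)) (B D0 : Finset (Fin m)),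
      Q.card = k → 2 * k ≤ D0.card + 1 → Disjoint D0 B → (∀ i ∈ Q, D0 ⊆ D i) →
      Term (W s) Q D B := by
  induction k with
  | zero =>
    intro s _ Q D B D0 hQ _ _ _ f S _ hs
    obtain ⟨⟨i, hi⟩, h2, _⟩ := hs 0
    rw [Finset.card_eq_zero.1 hQ] at h2
    simpa using h2 hi
  | succ k ih =>
    intro s hsk Q D B D0 hQ hD0 hdis hsub
    obtain ⟨q, hq⟩ : Q.Nonempty := Finset.card_pos.1 (by omega)
    obtain ⟨e, he⟩ : D0.Nonempty := Finset.card_pos.1 (by omega)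
    have heB : e ∉ B := fun h => (Finset.disjoint_left.1 hdis he) h
    have hcard : (D0.erase e).card + 1 = D0.card := Finset.card_erase_add_one he
    have hne : ∀ j ∈ Q, j ≠ q → (D0.erase e).Nonempty := by
      intro j hj hjq
      have : 1 < Q.card := Finset.one_lt_card.2 ⟨j, hj, q, hq, hjq⟩
      exact Finset.card_pos.1 (by omega)
    -- halting any player reduces to the induction hypothesis
    have hhalt : ∀ s ≥ k * n, ∀ D : Fin n → Finset (Fin m), (∀ i ∈ Q, D0.erase e ⊆ D i) →
        ∀ i ∈ Q, ∀ c, Term (W s) (Q.erase i) D (insert c B) := by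
      intro s hs D hD i hi c
      refine ih s hs _ D _ ((D0.erase e).erase c) ?_ ?_ ?_ ?_
      · rw [Finset.card_erase_of_mem hi]; omega
      · have := Finset.pred_card_le_card_erase (s := D0.erase e) (a := c)
        omega
      · rw [Finset.disjoint_left] at hdis ⊢
        intro x hx
        simp only [Finset.mem_erase] at hx
        simp only [Finset.mem_insert, not_or]
        exact ⟨hx.1, hdis hx.2.2⟩
      · intro j hj
        exact (Finset.erase_subset _ _).trans (hD j (Finset.mem_of_mem_erase hj))
    have inner : ∀ t, ∀ s0 ≥ k * n, ∀ D : Fin n → Finset (Fin m), (∀ i ∈ Q, D0.erase e ⊆ D i) →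
        e ∈ D q → (∀ i ∈ Q, i ≠ q → (∀ x < t, (s0 + x) % n ≠ i) → e ∉ D i) →
        Term (W (s0 + t)) Q D B := by
      intro t
      induction t with
      | zero =>
        intro s0 hs0 D h1 h2 h3
        refine priv (hG _) hq h2 heB ?_ (fun c _ => hhalt _ (by omega) D h1 q hq c)
        intro j hj hjq
        exact ⟨(hne j hj hjq).mono (h1 j hj), h3 j hj hjq (by simp)⟩
      | succ t iht =>
        intro s0 hs0 D h1 h2 h3
        have hr := hR (s0 + t)
        set p : Fin n := ⟨(s0 + t) % n, Nat.mod_lt _ hn⟩ with hpdef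
        have hpv : (p : ℕ) = (s0 + t) % n := rfl
        have key : ∀ i ∈ Q, i ≠ q → i ≠ p → (∀ x < t, (s0 + x) % n ≠ i) → e ∉ D i := by
          intro i hi hiq hip hx
          refine h3 i hi hiq ?_
          intro x hxt
          rcases Nat.lt_succ_iff_lt_or_eq.1 hxt with h | h
          · exact hx x h
          · subst h
            intro h
            exact hip (Fin.ext (by rw [hpv, h]))
        by_cases hp : p ∈ Q
        · by_cases hpq : p = q
          · refine hr.2 Q D B (D p) hp (Finset.Subset.refl _) ⟨e, hpq ▸ h2⟩ ?_
              (fun c _ => hhalt _ (by omega) D h1 p hp c)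
            rw [Function.update_eq_self]
            refine iht s0 hs0 D h1 h2 ?_
            intro i hi hiq hx
            exact key i hi hiq (fun h => hiq (h.trans hpq)) hx
          · refine hr.2 Q D B (D0.erase e) hp (h1 p hp) (hne p hp hpq) ?_
              (fun c _ => hhalt _ (by omega) D h1 p hp c)
            refine iht s0 hs0 _ ?_ ?_ ?_
            · intro i hi
              by_cases hip : i = p
              · subst hip; simp
              · rw [Function.update_of_ne hip]; exact h1 i hi
            · rw [Function.update_of_ne (Ne.symm hpq)]; exact h2
            · intro i hi hiq hx
              by_cases hip : i = p
              · subst hip; simp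
              · rw [Function.update_of_ne hip]; exact key i hi hiq hip hx
        · refine term_eq (fun i hi => ?_) (iht s0 hs0 D h1 h2 ?_)
          · have hip : i ≠ p := fun h => hp (h ▸ hi)
            exact congrFun (hr.1 i hip) _
          · intro i hi hiq hx
            exact key i hi hiq (fun h => hp (h ▸ hi)) hx
    have hsn : s = (s - n) + n := by
      rw [Nat.succ_mul] at hsk; omega
    rw [hsn]
    refine inner n (s - n) (by rw [Nat.succ_mul] at hsk; omega) D
      (fun i hi => (Finset.erase_subset _ _).trans (hsub i hi)) (hsub q hq he) ?_
    intro i hi hiq hx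
    exfalso
    -- some shift below `n` hits the residue of `i`
    have hi2 := i.2
    have hr := Nat.mod_lt (s - n) hn
    have hdm := Nat.mod_add_div (s - n) n
    by_cases hle : (s - n) % n ≤ i
    · refine hx (i - (s - n) % n) (by omega) ?_
      have : s - n + (i - (s - n) % n) = i + n * ((s - n) / n) := by omega
      rw [this, Nat.add_mul_mod_self_left, Nat.mod_eq_of_lt hi2]
    · refine hx (i + n - (s - n) % n) (by omega) ?_
      have : s - n + (i + n - (s - n) % n) = i + n + n * ((s - n) / n) := by omega
      rw [this, Nat.add_mul_mod_self_left, Nat.add_mod_right, Nat.mod_eq_of_lt hi2]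

theorem exists_seq (hn : 0 < n) (hm : 0 < m) : ∃ W : ℕ → Fam n m, (∀ s, Good (W s)) ∧
    ∀ s, Rel ⟨s % n, Nat.mod_lt _ hn⟩ (W s) (W (s + 1)) := by
  obtain ⟨W0, h0⟩ := exists_good (n := n) hm
  choose F hF1 hF2 using (exists_rel : ∀ (p : Fin n) (W : Fam n m) (_ : Good W),
    ∃ W', Good W' ∧ Rel p W W')
  let X : ℕ → {W : Fam n m // Good W} := fun s => Nat.rec ⟨W0, h0⟩
    (fun s Y => ⟨F ⟨s % n, Nat.mod_lt _ hn⟩ Y.1 Y.2, hF1 _ _ _⟩) s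
  exact ⟨fun s => (X s).1, fun s => (X s).2, fun s => hF2 _ _ (X s).2⟩

end MC

/-- For every `n ≥ 1` and `m ≥ 2n - 1` there exist `n` full words over an alphabet
of `m` chairs that constitute a winning strategy for the `MC(n,m)` game. -/
theorem stmt_0 (n m : ℕ) (hn : 1 ≤ n) (hm : 2 * n - 1 ≤ m) :
    ∃ π : Fin n → List (Fin m), (∀ i, MCFull (π i)) ∧ MCWinning π := by
  obtain ⟨W, hG, hR⟩ := MC.exists_seq (n := n) (m := m) (by omega) (by omega)
  have hT := MC.main (by omega) W hG hR n (n * n) le_rfl Finset.univ (fun _ => Finset.univ) ∅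
    Finset.univ (by simp) (by simp; omega) (by simp) (by simp)
  have hgood := hG (n * n)
  generalize W (n * n) = V at hT hgood
  obtain ⟨L, hL⟩ := hgood.1
  refine ⟨fun i => List.ofFn (fun x : Fin L => V i Finset.univ x), ?_, ?_⟩
  · intro i a
    obtain ⟨t, ht⟩ := hgood.2.2 i Finset.univ a (Finset.mem_univ _)
    rw [List.mem_ofFn]
    exact ⟨⟨t % L, Nat.mod_lt _ hL.1⟩, by simpa [MC.per_mod hL] using ht⟩
  · rintro ⟨f, hf⟩
    choose S h1 h2 h3 h4 using hf
    refine hT (fun t i x => V i Finset.univ ((f t i : ℕ) + x)) S ?_ ?_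
    · intro i _
      exact ⟨f 0 i, rfl⟩
    · intro t
      refine ⟨h1 t, Finset.subset_univ _, ?_, ?_, ?_⟩
      · intro i hi
        obtain ⟨j, hj, he⟩ := h2 t i hi
        right
        refine ⟨j, Finset.mem_univ _, hj, ?_⟩
        simpa using he
      · intro i hi
        funext x
        have := h3 t i hi
        simp only [List.length_ofFn] at this
        simp only
        rw [this, ← MC.per_mod hL, Nat.mod_add_mod, MC.per_mod hL]
        congr 1
        omega
      · intro i hi
        simp only
        rw [h4 t i hi]
end

section
/- For every integer n ≥ 1: (a) there exist full finite words s_1, s_2, …, s_n over the alphabet {1,…,2n−1} such that for every p ≤ n and every subset A ⊆ {1,…,2n−1} of cardinality |A| = 2p−1, the collection s_1(A), s_2(A), …, s_p(A) is terminal; and (b) there exist full finite words w_1, w_2, …, w_n over the alphabet {1,…,2n} such that for every p ≤ n and every subset B ⊆ {1,…,2n} of cardinality |B| = 2p−1, the collection w_1(B), w_2(B), …, w_p(B) is terminal. -/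
/-- A step in the linearly-traversed game (no wrap-around): a nonempty set `S` of
players, each in conflict and not at the last position of its word, advances by one. -/
def LStep {C : Type} {p : ℕ} (w : Fin p → List C)
    (c c' : ∀ i, Fin (w i).length) : Prop :=
  ∃ S : Finset (Fin p), S.Nonempty ∧
    (∀ i ∈ S, (∃ j, j ≠ i ∧ (w j).get (c j) = (w i).get (c i)) ∧
      (c i : ℕ) + 1 < (w i).length) ∧
    (∀ i ∈ S, ((c' i : ℕ) = (c i : ℕ) + 1)) ∧
    (∀ i ∉ S, c' i = c i)

/-- A collection of words is terminal if in no run does some player occupy the first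
position of its word at some time and the last position at a (weakly) later time,
i.e. no word is ever fully traversed. -/
def Terminal {C : Type} {p : ℕ} (w : Fin p → List C) : Prop :=
  ¬ ∃ (f : ℕ → ∀ i, Fin (w i).length) (i : Fin p) (t₁ t₂ : ℕ),
      t₁ ≤ t₂ ∧ (∀ t, t < t₂ → LStep w (f t) (f (t + 1))) ∧
      (f t₁ i : ℕ) = 0 ∧ (f t₂ i : ℕ) + 1 = (w i).length

/-- `restrictWord l A` is the word obtained from `l` by deleting all letters not in `A`. -/
def restrictWord {m : ℕ} (l : List (Fin m)) (A : Finset (Fin m)) : List (Fin m) :=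
  l.filter (fun a => a ∈ A)



/-- Extended runs: letters outside `A` are transparent (a player may always leave them). -/
def IsRun (u : ℕ → ℕ → ℕ) (A P : Finset ℕ) (f : ℕ → ℕ → ℕ) (s s' : ℕ) : Prop :=
  ∀ t, s ≤ t → t < s' → ∀ j ∈ P, f (t + 1) j = f t j ∨
    (f (t + 1) j = f t j + 1 ∧
      (u j (f t j) ∉ A ∨ ∃ k ∈ P, k ≠ j ∧ u k (f t k) = u j (f t j)))

def Good (n m : ℕ) (u : ℕ → ℕ → ℕ) (L : ℕ → ℕ) : Prop :=
  (∀ i x, u i x < m) ∧ ∀ P ⊆ Finset.range n, ∀ A ⊆ Finset.range m, 2 * P.card ≤ A.card + 1 →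
    ∀ f s s', s ≤ s' → IsRun u A P f s s' → ∀ i ∈ P, f s' i < f s i + L i

lemma mono_aux (h : ℕ → ℕ) (s T : ℕ) (hstep : ∀ t, s ≤ t → t < T → h t ≤ h (t + 1)) :
    ∀ a b, s ≤ a → a ≤ b → b ≤ T → h a ≤ h b := by
  intro a b ha hab
  induction b, hab using Nat.le_induction with
  | base => intro _; exact le_rfl
  | succ b hb ih => intro hT; exact (ih (by omega)).trans (hstep b (by omega) (by omega))

lemma move_aux (h : ℕ → ℕ) (s T x : ℕ)
    (hstep : ∀ t, s ≤ t → t < T → h (t + 1) = h t ∨ h (t + 1) = h t + 1)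
    (hs : h s ≤ x) (hT : x < h T) (hsT : s ≤ T) :
    ∃ t, s ≤ t ∧ t < T ∧ h t = x ∧ h (t + 1) = x + 1 := by
  induction T, hsT using Nat.le_induction with
  | base => omega
  | succ T hT' ih =>
    by_cases hx : x < h T
    · obtain ⟨t, h1, h2, h3⟩ := ih (fun t a b => hstep t a (by omega)) hx
      exact ⟨t, h1, by omega, h3⟩
    · refine ⟨T, hT', by omega, ?_⟩
      rcases hstep T hT' (by omega) with h1 | h1 <;> omega

lemma ivt_aux (h : ℕ → ℕ) (s T x : ℕ)
    (hstep : ∀ t, s ≤ t → t < T → h (t + 1) = h t ∨ h (t + 1) = h t + 1)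
    (hs : h s ≤ x) (hT : x ≤ h T) (hsT : s ≤ T) :
    ∃ t, s ≤ t ∧ t ≤ T ∧ h t = x := by
  rcases hT.eq_or_lt with h1 | h1
  · exact ⟨T, hsT, le_rfl, h1.symm⟩
  · obtain ⟨t, a, b, c, _⟩ := move_aux h s T x hstep hs h1 hsT
    exact ⟨t, a, b.le, c⟩

lemma pig_aux (h Φ : ℕ → ℕ) (T L G : ℕ) : ∀ (s a : ℕ)
    (_ : ∀ t, s ≤ t → t < T → h (t + 1) = h t ∨ h (t + 1) = h t + 1)
    (_ : ∀ t, s ≤ t → t < T → Φ t ≤ Φ (t + 1))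
    (_ : h s ≤ a) (_ : a + G * L ≤ h T) (_ : Φ T < Φ s + G) (_ : s ≤ T),
    ∃ r1 r2 g, s ≤ r1 ∧ r1 ≤ r2 ∧ r2 ≤ T ∧ g < G ∧ h r1 = a + g * L ∧ h r2 = a + g * L + L ∧
      Φ r1 = Φ r2 := by
  induction G with
  | zero =>
    intro s a h1 h2 h3 h4 h5 h6
    have := mono_aux Φ s T h2 s T le_rfl h6 le_rfl
    omega
  | succ G ih =>
    intro s a h1 h2 h3 h4 h5 h6
    have e : (G + 1) * L = G * L + L := by ring
    rw [e] at h4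
    obtain ⟨t0, a0, b0, c0⟩ := ivt_aux h s T a h1 h3 (by omega) h6
    obtain ⟨t1, a1, b1, c1⟩ := ivt_aux h t0 T (a + L) (fun t p q => h1 t (by omega) q)
      (by omega) (by omega) b0
    by_cases hΦ : Φ t0 = Φ t1
    · exact ⟨t0, t1, 0, a0, a1, b1, by omega, by omega, by omega, hΦ⟩
    · have m1 := mono_aux Φ s T h2 s t0 le_rfl a0 b0
      have m2 := mono_aux Φ s T h2 t0 t1 a0 a1 b1
      obtain ⟨r1, r2, g, q1, q2, q3, q4, q5, q6, q7⟩ := ih t1 (a + L)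
        (fun t p q => h1 t (by omega) q) (fun t p q => h2 t (by omega) q)
        (by omega) (by omega) (by omega) b1
      have e2 : (g + 1) * L = g * L + L := by ring
      exact ⟨r1, r2, g + 1, by omega, q2, q3, by omega, by omega, by omega, q7⟩

lemma exists_N (n : ℕ) (c L : ℕ → ℕ) :
    ∃ N : ℕ → ℕ, ∀ j, (1 + ∑ k ∈ Finset.Ioo j n, (c k + 1) * N k) * L j + 1 ≤ N j := by
  have key : ∀ d, ∃ N : ℕ → ℕ, ∀ j, n ≤ j + d →
      (1 + ∑ k ∈ Finset.Ioo j n, (c k + 1) * N k) * L j + 1 ≤ N j := by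
    intro d
    induction d with
    | zero =>
      refine ⟨fun j => L j + 1, fun j hj => ?_⟩
      rw [Finset.Ioo_eq_empty (by omega)]; simp
    | succ d ih =>
      obtain ⟨N, hN⟩ := ih
      refine ⟨fun j => if n ≤ j + d then N j else
        (1 + ∑ k ∈ Finset.Ioo j n, (c k + 1) * N k) * L j + 1, fun j hj => ?_⟩
      have hs : ∑ k ∈ Finset.Ioo j n, (c k + 1) * (if n ≤ k + d then N k else
          (1 + ∑ l ∈ Finset.Ioo k n, (c l + 1) * N l) * L k + 1)
          = ∑ k ∈ Finset.Ioo j n, (c k + 1) * N k := by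
        refine Finset.sum_congr rfl fun k hk => ?_
        rw [Finset.mem_Ioo] at hk
        rw [if_pos (by omega)]
      simp only [hs]
      split_ifs with h
      · exact hN j h
      · exact le_rfl
  obtain ⟨N, hN⟩ := key n
  exact ⟨N, fun j => hN j (by omega)⟩

lemma c_sum (j : ℕ) : 3 + 2 * ∑ k ∈ Finset.range j, 4 ^ (k + 1) ≤ 4 ^ (j + 1) := by
  induction j with
  | zero => simp
  | succ j ih => rw [Finset.sum_range_succ, pow_succ 4 (j + 1)]; omega

lemma IsRun.sub {u A P f s T s1 T1} (h : IsRun u A P f s T) (h1 : s ≤ s1) (h2 : T1 ≤ T) :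
    IsRun u A P f s1 T1 := fun t a b => h t (by omega) (by omega)

lemma IsRun.step {u A P f s T} (h : IsRun u A P f s T) {j : ℕ} (hj : j ∈ P) :
    ∀ t, s ≤ t → t < T → f (t + 1) j = f t j ∨ f (t + 1) j = f t j + 1 := by
  intro t a b
  rcases h t a b j hj with h | h
  · exact Or.inl h
  · exact Or.inr h.1

lemma IsRun.mono {u A P f s T} (h : IsRun u A P f s T) {j : ℕ} (hj : j ∈ P) :
    ∀ a b, s ≤ a → a ≤ b → b ≤ T → f a j ≤ f b j :=
  mono_aux (fun t => f t j) s T (fun t a b => by rcases h.step hj t a b with h | h <;> simp [h])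

lemma mod_succ_of_div_eq (x N : ℕ) (h : (x + 1) / N = x / N) : (x + 1) % N = x % N + 1 := by
  have h1 := Nat.div_add_mod x N
  have h2 := Nat.div_add_mod (x + 1) N
  rw [h] at h2
  omega

def blockWord (m : ℕ) (u : ℕ → ℕ → ℕ) (N : ℕ → ℕ) (j x : ℕ) : ℕ :=
  if (x / N j) % 2 = 0 then u j (x % N j) else m

lemma core {n m : ℕ} {u : ℕ → ℕ → ℕ} {L N : ℕ → ℕ} (hu : Good n m u L)
    (hN : ∀ j, (1 + ∑ k ∈ Finset.Ioo j n, (4 ^ (k + 1) + 1) * N k) * L j + 1 ≤ N j)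
    {P A : Finset ℕ} (hP : P ⊆ Finset.range n) (hA : A ⊆ Finset.range (m + 1))
    (hPA : 2 * P.card ≤ A.card + 1) {f : ℕ → ℕ → ℕ} {s T : ℕ} (hsT : s ≤ T)
    (hrun : IsRun (blockWord m u N) A P f s T)
    (hub : ∀ k ∈ P, f T k / N k ≤ f s k / N k + 4 ^ (k + 1))
    {j : ℕ} (hj : j ∈ P) (hviol : f s j / N j + 4 ^ (j + 1) ≤ f T j / N j) : False := by
  have hN0 : ∀ k, 0 < N k := fun k => by have := hN k; omega
  set Plow := P.filter (· < j) with hPlow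
  set Phi := P.filter (j < ·) with hPhi
  set b0 := f s j / N j with hb0
  -- outer pigeonhole
  obtain ⟨s1, s2, g, q1, q2, q3, q4, q5, q6, q7⟩ := pig_aux (fun t => f t j)
    (fun t => ∑ k ∈ Plow, f t k / N k) T (2 * N j) (1 + ∑ k ∈ Plow, 4 ^ (k + 1)) s
    ((b0 + 1) * N j) (hrun.step hj)
    (fun t a b => Finset.sum_le_sum fun k hk => Nat.div_le_div_right
      (hrun.mono (Finset.mem_filter.1 hk).1 t (t + 1) a (by omega) (by omega)))
    (by
      have := Nat.lt_mul_div_succ (f s j) (hN0 j)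
      rw [mul_comm] at this; exact this.le)
    (by
      have h1 : ∑ k ∈ Plow, 4 ^ (k + 1) ≤ ∑ k ∈ Finset.range j, 4 ^ (k + 1) :=
        Finset.sum_le_sum_of_subset (fun k hk => by
          rw [Finset.mem_range]; exact (Finset.mem_filter.1 hk).2)
      have h2 := c_sum j
      have h3 := (Nat.le_div_iff_mul_le (hN0 j)).1 hviol
      refine le_trans ?_ h3
      have : (b0 + 1) * N j + (1 + ∑ k ∈ Plow, 4 ^ (k + 1)) * (2 * N j)
        = (b0 + 1 + 2 * (1 + ∑ k ∈ Plow, 4 ^ (k + 1))) * N j := by ring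
      rw [this]
      exact Nat.mul_le_mul_right _ (by omega))
    (by
      have : ∑ k ∈ Plow, f T k / N k ≤ ∑ k ∈ Plow, (f s k / N k + 4 ^ (k + 1)) :=
        Finset.sum_le_sum fun k hk => hub k (Finset.mem_filter.1 hk).1
      rw [Finset.sum_add_distrib] at this
      omega)
    hsT
  have hlow : ∀ k ∈ Plow, ∀ t, s1 ≤ t → t ≤ s2 → f t k / N k = f s1 k / N k := by
    have hm : ∀ k ∈ Plow, f s1 k / N k ≤ f s2 k / N k := fun k hk =>
      Nat.div_le_div_right (hrun.mono (Finset.mem_filter.1 hk).1 s1 s2 q1 q2 q3)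
    have he := (Finset.sum_eq_sum_iff_of_le hm).1 q7
    intro k hk t h1 h2
    have h3 := he k hk
    have h4 : f s1 k / N k ≤ f t k / N k :=
      Nat.div_le_div_right (hrun.mono (Finset.mem_filter.1 hk).1 s1 t q1 h1 (by omega))
    have h5 : f t k / N k ≤ f s2 k / N k :=
      Nat.div_le_div_right (hrun.mono (Finset.mem_filter.1 hk).1 t s2 (by omega) h2 q3)
    omega
  set B := b0 + 1 + 2 * g with hB
  have e1 : f s1 j = B * N j := by rw [q5, hB]; ring
  have e2 : f s2 j = (B + 2) * N j := by rw [q6, hB]; ring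
  set PU := Plow.filter (fun k => (f s1 k / N k) % 2 = 0) with hPU
  set PM := Plow.filter (fun k => ¬ (f s1 k / N k) % 2 = 0) with hPM
  have hc1 : PU.card + PM.card = Plow.card := Finset.card_filter_add_card_filter_not _
  have hc2 : P.card = Plow.card + Phi.card + 1 := by
    have hPe : P = insert j (Plow ∪ Phi) := by
      ext k
      simp only [hPlow, hPhi, Finset.mem_insert, Finset.mem_union, Finset.mem_filter]
      constructor
      · intro h; rcases lt_trichotomy k j with h1 | h1 | h1 <;> simp [h, h1]
      · rintro (h | h | h)
        · exact h ▸ hj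
        · exact h.1
        · exact h.1
    have hd : Disjoint Plow Phi := by
      rw [Finset.disjoint_left]
      intro k h1 h2
      have := (Finset.mem_filter.1 h1).2
      have := (Finset.mem_filter.1 h2).2
      omega
    rw [hPe, Finset.card_insert_of_notMem, Finset.card_union_of_disjoint hd]
    simp [hPlow, hPhi]
  set A0 := A.filter (· < m) with hA0
  have hcA : A.card ≤ A0.card + (if m ∈ A then 1 else 0) := by
    have hsub : A ⊆ A0 ∪ (if m ∈ A then {m} else ∅) := by
      intro a ha
      have := Finset.mem_range.1 (hA ha)
      rw [Finset.mem_union, hA0, Finset.mem_filter]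
      by_cases h : a < m
      · exact Or.inl ⟨ha, h⟩
      · have : a = m := by omega
        subst this; right; simp [ha]
    refine (Finset.card_le_card hsub).trans ((Finset.card_union_le _ _).trans ?_)
    split_ifs <;> simp
  by_cases hcase : 2 * PU.card + 1 + Phi.card ≤ A0.card
  · -- the even block
    obtain ⟨ev, hev1, hev2, hev3⟩ : ∃ ev, B ≤ ev ∧ ev + 1 ≤ B + 2 ∧ ev % 2 = 0 := by
      rcases Nat.mod_two_eq_zero_or_one B with h | h
      · exact ⟨B, by omega, by omega, h⟩
      · exact ⟨B + 1, by omega, by omega, by omega⟩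
    have hm1 : B * N j ≤ ev * N j := Nat.mul_le_mul_right _ hev1
    have hm2 : (ev + 1) * N j ≤ (B + 2) * N j := Nat.mul_le_mul_right _ hev2
    have hm3 : (ev + 1) * N j = ev * N j + N j := by ring
    have hrun' := hrun.sub q1 q3
    have hNj := hN j
    set G' := 1 + ∑ k ∈ Finset.Ioo j n, (4 ^ (k + 1) + 1) * N k with hG'
    obtain ⟨r1, r2, g', p1, p2, p3, p4, p5, p6, p7⟩ := pig_aux (fun t => f t j)
      (fun t => ∑ k ∈ Phi, f t k) s2 (L j) G' s1 (ev * N j) (hrun'.step hj)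
      (fun t a b => Finset.sum_le_sum fun k hk =>
        hrun'.mono (Finset.mem_filter.1 hk).1 t (t + 1) a (by omega) (by omega))
      (by (try simp only); omega) (by (try simp only); omega)
      (by
        have h1 : ∀ k ∈ Phi, f s2 k ≤ f s1 k + (4 ^ (k + 1) + 1) * N k := by
          intro k hk
          have hkP := (Finset.mem_filter.1 hk).1
          have h1 := hrun.mono hkP s s1 le_rfl q1 (by omega)
          have h2 := hrun.mono hkP s2 T (by omega) q3 le_rfl
          have h3 := Nat.lt_mul_div_succ (f T k) (hN0 k)
          have h4 : N k * (f T k / N k + 1) ≤ N k * (f s k / N k + 4 ^ (k + 1) + 1) :=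
            Nat.mul_le_mul_left _ (by have := hub k hkP; omega)
          have h5 := Nat.mul_div_le (f s k) (N k)
          have h6 : N k * (f s k / N k + 4 ^ (k + 1) + 1)
            = N k * (f s k / N k) + (4 ^ (k + 1) + 1) * N k := by ring
          omega
        have h2 := Finset.sum_le_sum h1
        rw [Finset.sum_add_distrib] at h2
        have h3 : ∑ k ∈ Phi, (4 ^ (k + 1) + 1) * N k
            ≤ ∑ k ∈ Finset.Ioo j n, (4 ^ (k + 1) + 1) * N k :=
          Finset.sum_le_sum_of_subset (fun k hk => by
            have := Finset.mem_filter.1 hk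
            rw [Finset.mem_Ioo]
            exact ⟨this.2, Finset.mem_range.1 (hP this.1)⟩)
        (try simp only); omega) q2
    try simp only at p5 p6 p7
    have hstuck : ∀ k ∈ Phi, ∀ t, r1 ≤ t → t ≤ r2 → f t k = f r1 k := by
      have hm : ∀ k ∈ Phi, f r1 k ≤ f r2 k := fun k hk =>
        hrun'.mono (Finset.mem_filter.1 hk).1 r1 r2 p1 p2 p3
      have he := (Finset.sum_eq_sum_iff_of_le hm).1 p7
      intro k hk t h1 h2
      have h3 := he k hk
      have h4 := hrun'.mono (Finset.mem_filter.1 hk).1 r1 t p1 h1 (by omega)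
      have h5 := hrun'.mono (Finset.mem_filter.1 hk).1 t r2 (by omega) h2 p3
      omega
    have hgL : g' * L j + L j ≤ G' * L j := by
      rw [← Nat.succ_mul]; exact Nat.mul_le_mul_right _ p4
    have hjblock : ∀ t, r1 ≤ t → t ≤ r2 → f t j / N j = ev := by
      intro t h1 h2
      have h4 := hrun'.mono hj r1 t p1 h1 (by omega)
      have h5 := hrun'.mono hj t r2 (by omega) h2 p3
      rw [Nat.div_eq_iff (hN0 j)]
      constructor <;> omega
    -- simulated run
    set P' := insert j PU with hP'
    set A' := A0 \ Phi.image (fun k => blockWord m u N k (f r1 k)) with hA'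
    have hP'P : P' ⊆ P := by
      intro k hk
      rcases Finset.mem_insert.1 hk with h | h
      · exact h ▸ hj
      · exact (Finset.mem_filter.1 (Finset.mem_filter.1 h).1).1
    have hblk : ∀ k ∈ P', ∀ t, r1 ≤ t → t ≤ r2 → f t k / N k = f r1 k / N k := by
      intro k hk t h1 h2
      rcases Finset.mem_insert.1 hk with h | h
      · subst h; rw [hjblock t h1 h2, hjblock r1 le_rfl p2]
      · have := (Finset.mem_filter.1 h).1
        rw [hlow k this t (by omega) (by omega), hlow k this r1 (by omega) (by omega)]
    have hlet : ∀ k ∈ P', ∀ t, r1 ≤ t → t ≤ r2 →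
        blockWord m u N k (f t k) = u k (f t k % N k) := by
      intro k hk t h1 h2
      unfold blockWord
      rw [if_pos]
      rcases Finset.mem_insert.1 hk with h | h
      · subst h; rw [hjblock t h1 h2]; exact hev3
      · have := Finset.mem_filter.1 h
        rw [hlow k this.1 t (by omega) (by omega)]; exact this.2
    have hsim : IsRun u A' P' (fun t k => f t k % N k) r1 r2 := by
      intro t h1 h2 k hk
      have hl := hlet k hk t h1 h2.le
      rcases hrun t (by omega) (by omega) k (hP'P hk) with h | ⟨h, h'⟩
      · left; simp only [h]
      · right
        refine ⟨?_, ?_⟩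
        · simp only [h]
          apply mod_succ_of_div_eq
          rw [← h, hblk k hk (t + 1) (by omega) (by omega), hblk k hk t h1 h2.le]
        · rw [hl] at h'
          simp only
          rcases h' with h' | ⟨l, hl1, hl2, hl3⟩
          · left
            intro hc
            exact h' (Finset.mem_filter.1 (Finset.mem_sdiff.1 hc).1).1
          · by_cases hlP : l ∈ P'
            · right
              exact ⟨l, hlP, hl2, by rw [← hl3, hlet l hlP t h1 h2.le]⟩
            · left
              rw [← hl3]
              intro hc
              have hc1 := Finset.mem_sdiff.1 hc
              have hlj : l ≠ j := fun h => hlP (h ▸ Finset.mem_insert_self _ _)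
              rcases lt_or_gt_of_ne hlj with h5 | h5
              · have hll : l ∈ Plow := Finset.mem_filter.2 ⟨hl1, h5⟩
                have hodd : ¬ (f s1 l / N l) % 2 = 0 := fun h6 =>
                  hlP (Finset.mem_insert_of_mem (Finset.mem_filter.2 ⟨hll, h6⟩))
                have h7 : blockWord m u N l (f t l) = m := by
                  unfold blockWord
                  rw [hlow l hll t (by omega) (by omega), if_neg hodd]
                have h8 := hu.1 k (f t k % N k)
                omega
              · have hll : l ∈ Phi := Finset.mem_filter.2 ⟨hl1, h5⟩
                apply hc1.2
                rw [hstuck l hll t h1 h2.le]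
                exact Finset.mem_image_of_mem _ hll
    have hfin := hu.2 P' (hP'P.trans hP) A' (by
        intro a ha
        exact Finset.mem_range.2 (Finset.mem_filter.1 (Finset.mem_sdiff.1 ha).1).2)
      (by
        have h1 : P'.card ≤ PU.card + 1 := Finset.card_insert_le _ _
        have h2 := Finset.le_card_sdiff (Phi.image (fun k => blockWord m u N k (f r1 k))) A0
        have h3 := Finset.card_image_le (s := Phi) (f := fun k => blockWord m u N k (f r1 k))
        rw [← hA'] at h2; omega) _ r1 r2 p2 hsim j (Finset.mem_insert_self _ _)
    try simp only at hfin
    have d1 := Nat.div_add_mod (f r1 j) (N j)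
    have d2 := Nat.div_add_mod (f r2 j) (N j)
    rw [hjblock r1 le_rfl p2] at d1
    rw [hjblock r2 p2 le_rfl] at d2
    omega
  · -- the odd block
    have hm : m ∈ A ∧ PM.card = 0 ∧ Phi.card = 0 := by
      by_cases hmA : m ∈ A
      · simp only [hmA, if_true] at hcA
        exact ⟨hmA, by omega, by omega⟩
      · simp only [hmA, if_false] at hcA
        omega
    obtain ⟨hmA, hPM0, hPhi0⟩ := hm
    rw [Finset.card_eq_zero] at hPM0 hPhi0
    obtain ⟨od, hod1, hod2, hod3⟩ : ∃ od, B ≤ od ∧ od + 1 ≤ B + 2 ∧ od % 2 = 1 := by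
      rcases Nat.mod_two_eq_zero_or_one B with h | h
      · exact ⟨B + 1, by omega, by omega, by omega⟩
      · exact ⟨B, by omega, by omega, h⟩
    have hm1 : B * N j ≤ od * N j := Nat.mul_le_mul_right _ hod1
    have hm2 : (od + 1) * N j ≤ (B + 2) * N j := Nat.mul_le_mul_right _ hod2
    have hm3 : (od + 1) * N j = od * N j + N j := by ring
    have hNj := hN0 j
    obtain ⟨t, t1, t2, t3, t4⟩ := move_aux (fun t => f t j) s1 s2 (od * N j)
      ((hrun.sub q1 q3).step hj) (by (try simp only); omega) (by (try simp only); omega) q2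
    try simp only at t3 t4
    have hlm : blockWord m u N j (f t j) = m := by
      unfold blockWord
      rw [t3, Nat.mul_div_cancel _ hNj, if_neg (by omega)]
    rcases hrun t (by omega) (by omega) j hj with h | ⟨_, h⟩
    · omega
    · rw [hlm] at h
      rcases h with h | ⟨k, hk, hkj, hkl⟩
      · exact h hmA
      · rcases lt_or_gt_of_ne hkj with h5 | h5
        · have hkk : k ∈ Plow := Finset.mem_filter.2 ⟨hk, h5⟩
          have hE : (f s1 k / N k) % 2 = 0 := by
            by_contra hc
            have : k ∈ PM := Finset.mem_filter.2 ⟨hkk, hc⟩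
            rw [hPM0] at this
            simp at this
          unfold blockWord at hkl
          rw [hlow k hkk t (by omega) (by omega), if_pos hE] at hkl
          have := hu.1 k (f t k % N k)
          omega
        · have : k ∈ Phi := Finset.mem_filter.2 ⟨hk, h5⟩
          rw [hPhi0] at this
          simp at this

lemma good_succ {n m : ℕ} {u : ℕ → ℕ → ℕ} {L : ℕ → ℕ} (hu : Good n m u L) :
    ∃ u' L', Good n (m + 1) u' L' := by
  obtain ⟨N, hN⟩ := exists_N n (fun k => 4 ^ (k + 1)) L
  have hN0 : ∀ k, 0 < N k := fun k => by have := hN k; omega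
  refine ⟨blockWord m u N, fun j => (4 ^ (j + 1) + 1) * N j, ?_, ?_⟩
  · intro i x
    unfold blockWord
    split_ifs
    · have := hu.1 i (x % N i); omega
    · omega
  · intro P hP A hA hPA f s s' hss' hrun
    have main : ∀ T, s ≤ T → T ≤ s' → ∀ j ∈ P, f T j / N j < f s j / N j + 4 ^ (j + 1) := by
      intro T hT
      induction T, hT using Nat.le_induction with
      | base => intro _ j _; have : 0 < 4 ^ (j + 1) := by positivity
                omega
      | succ T hT ih =>
        intro hTs j hj
        by_contra hc
        refine core hu hN hP hA hPA (by omega) (hrun.sub le_rfl hTs) ?_ hj (not_lt.1 hc)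
        intro k hk
        have h1 := ih (by omega) k hk
        have h2 : f (T + 1) k / N k ≤ f T k / N k + 1 := by
          rw [← Nat.add_div_right _ (hN0 k)]
          apply Nat.div_le_div_right
          have := hN0 k
          rcases hrun.step hk T hT (by omega) with h | h <;> omega
        omega
    intro i hi
    have h1 := main s' hss' le_rfl i hi
    have h3 := Nat.lt_mul_div_succ (f s' i) (hN0 i)
    have h4 : N i * (f s' i / N i + 1) ≤ N i * (f s i / N i + 4 ^ (i + 1)) :=
      Nat.mul_le_mul_left _ h1
    have h5 := Nat.mul_div_le (f s i) (N i)
    have h6 : N i * (f s i / N i + 4 ^ (i + 1))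
      = N i * (f s i / N i) + 4 ^ (i + 1) * N i := by ring
    have h7 : (4 ^ (i + 1) + 1) * N i = 4 ^ (i + 1) * N i + N i := by ring
    simp only; omega

lemma exists_good (n m : ℕ) (hm : 1 ≤ m) : ∃ u L, Good n m u L := by
  induction m, hm using Nat.le_induction with
  | base =>
    refine ⟨fun _ _ => 0, fun _ => 1, fun _ _ => by simp, ?_⟩
    intro P hP A hA hPA f s s' hss' hrun i hi
    have hA1 := Finset.card_le_card hA
    simp only [Finset.card_range] at hA1
    have hPc : 0 < P.card := Finset.card_pos.2 ⟨i, hi⟩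
    have hAe : A = Finset.range 1 := Finset.eq_of_subset_of_card_le hA (by rw [Finset.card_range]; omega)
    obtain ⟨x, hx⟩ := Finset.card_eq_one.1 (show P.card = 1 by omega)
    have : ∀ T, s ≤ T → T ≤ s' → f T i = f s i := by
      intro T hT
      induction T, hT using Nat.le_induction with
      | base => intro _; rfl
      | succ T hT ih =>
        intro h
        rcases hrun T hT (by omega) i hi with h1 | ⟨_, h1 | ⟨k, hk, hki, _⟩⟩
        · rw [h1, ih (by omega)]
        · simp [hAe] at h1
        · rw [hx, Finset.mem_singleton] at hk hi
          exact absurd (hk.trans hi.symm) hki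
    simp only [this s' hss' le_rfl]; omega
  | succ m hm ih =>
    obtain ⟨u, L, h⟩ := ih
    exact good_succ h

lemma restrict_facts {M : ℕ} (v : ℕ → Fin M) (len : ℕ) (A : Finset (Fin M)) :
    ∃ q : ℕ → ℕ,
      (∀ r (h : r < (restrictWord ((List.range len).map v) A).length),
        q r < len ∧ v (q r) = (restrictWord ((List.range len).map v) A).get ⟨r, h⟩) ∧
      (∀ r r', r < r' → r' < (restrictWord ((List.range len).map v) A).length → q r < q r') ∧
      (∀ x, x < len → v x ∈ A →
        ∃ r, r < (restrictWord ((List.range len).map v) A).length ∧ q r = x) := by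
  set R := (List.range len).filter (fun x => decide (v x ∈ A)) with hR
  have hl : restrictWord ((List.range len).map v) A = R.map v := by
    unfold restrictWord
    rw [List.filter_map]
    rfl
  have hmem : ∀ x, x ∈ R ↔ x < len ∧ v x ∈ A := by intro x; simp [hR]
  have hsort : R.Pairwise (· < ·) := List.pairwise_lt_range.filter _
  rw [hl]
  refine ⟨fun r => R.getD r 0, ?_, ?_, ?_⟩
  · intro r h
    have h' : r < R.length := by simpa using h
    have := (hmem R[r]).1 (List.getElem_mem h')
    simp [h', this.1]
  · intro r r' h1 h2
    have h2' : r' < R.length := by simpa using h2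
    have h1' : r < R.length := by omega
    have := List.pairwise_iff_getElem.1 hsort r r' h1' h2' h1
    simpa [h1', h2'] using this
  · intro x h1 h2
    obtain ⟨r, hr, hx⟩ := List.getElem_of_mem ((hmem x).2 ⟨h1, h2⟩)
    exact ⟨r, by simpa using hr, by simp [hr, hx]⟩

lemma good_freq {n m : ℕ} {u : ℕ → ℕ → ℕ} {L : ℕ → ℕ} (hu : Good n m u L)
    {i a : ℕ} (hi : i < n) (ha : a < m) (s : ℕ) : ∃ x, s ≤ x ∧ x < s + L i ∧ u i x = a := by
  by_contra hc
  push Not at hc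
  have := hu.2 {i} (by simpa using hi) {a} (by simpa using ha) (by simp)
    (fun t _ => t) s (s + L i) (by omega) (by
      intro t h1 h2 j hj
      right
      refine ⟨rfl, Or.inl ?_⟩
      rw [Finset.mem_singleton] at hj
      subst hj
      simpa using hc t h1 h2) i (by simp)
  omega

lemma final_words (n M : ℕ) (hM : 1 ≤ M) :
    ∃ s : Fin n → List (Fin M), (∀ i, ∀ a : Fin M, a ∈ s i) ∧
      ∀ (p : ℕ) (hp : p ≤ n), 1 ≤ p → ∀ A : Finset (Fin M), A.card = 2 * p - 1 →
        Terminal (fun j : Fin p => restrictWord (s (Fin.castLE hp j)) A) := by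
  obtain ⟨u, L, hu⟩ := exists_good n M hM
  set v : ℕ → ℕ → Fin M := fun i x => ⟨u i x, hu.1 i x⟩ with hv
  refine ⟨fun i => (List.range (3 * L i)).map (v i), ?_, ?_⟩
  · intro i a
    obtain ⟨x, _, h2, h3⟩ := good_freq hu i.2 a.2 0
    rw [List.mem_map]
    exact ⟨x, by rw [List.mem_range]; omega, Fin.ext h3⟩
  intro p hp hp1 A hA
  rintro ⟨f, i, t1, t2, ht, hstep, hf1, hf2⟩
  have hex := fun j : ℕ => restrict_facts (v j) (3 * L j) A
  choose Q hQ1 hQ2 hQ3 using hex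
  simp only [Fin.val_castLE] at f hstep hf1 hf2
  set D := 1 + ∑ j ∈ Finset.range n, 3 * L j with hD
  have hDle : ∀ j, j < n → 3 * L j < D := by
    intro j hj
    have := Finset.single_le_sum (f := fun j => 3 * L j) (fun _ _ => Nat.zero_le _)
      (Finset.mem_range.2 hj)
    try simp only at this
    omega
  set q : ℕ → ℕ → ℕ := fun t j => if h : j < p then Q j (f t ⟨j, h⟩) else 0 with hq
  have hqv : ∀ t (j : Fin p), q t j = Q j (f t j) := by
    intro t j; simp [hq]
  set g : ℕ → ℕ → ℕ := fun τ j => min (q (τ / D) j + τ % D) (max (q (τ / D) j) (q (τ / D + 1) j))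
    with hg
  have hD0 : 0 < D := by omega
  have hgD : ∀ t j, g (t * D) j = q t j := by
    intro t j; simp [hg, Nat.mul_div_cancel _ hD0]
  have hqlt : ∀ t (j : Fin p), q t j < D := by
    intro t j
    rw [hqv]
    exact (hQ1 j (f t j) (f t j).2).1.trans (hDle j (by omega))
  have hrun : IsRun u (A.image Fin.val) (Finset.range p) g 0 (t2 * D) := by
    intro τ _ hτ j hj
    have hjp := Finset.mem_range.1 hj
    have hτ' : τ / D < t2 := (Nat.div_lt_iff_lt_mul hD0).2 hτ
    obtain ⟨S, _, hS1, hS2, hS3⟩ := hstep (τ / D) hτ'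
    -- next value
    have hnext : g (τ + 1) j = min (q (τ / D) j + τ % D + 1)
        (max (q (τ / D) j) (q (τ / D + 1) j)) := by
      by_cases hlast : τ % D + 1 = D
      · have e : τ + 1 = (τ / D + 1) * D := by
          have := Nat.div_add_mod τ D
          rw [Nat.add_mul, mul_comm]; omega
        rw [e, hgD]
        have h1 := hqlt (τ / D) ⟨j, hjp⟩
        have h2 := hqlt (τ / D + 1) ⟨j, hjp⟩
        simp only at h1 h2
        have h3 : q (τ / D) j ≤ q (τ / D + 1) j := by
          by_cases hjS : (⟨j, hjp⟩ : Fin p) ∈ S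
          · have ha := hS2 _ hjS
            have hb := (f (τ / D + 1) ⟨j, hjp⟩).2
            have hc := hqv (τ / D) ⟨j, hjp⟩
            have hd := hqv (τ / D + 1) ⟨j, hjp⟩
            simp only at hc hd
            rw [hc, hd]
            exact (hQ2 j _ _ (by omega) hb).le
          · have ha := hS3 _ hjS
            have hc := hqv (τ / D) ⟨j, hjp⟩
            have hd := hqv (τ / D + 1) ⟨j, hjp⟩
            simp only at hc hd
            rw [hc, hd, ha]
        omega
      · have hlt := Nat.mod_lt τ hD0
        have e1 : (τ + 1) / D = τ / D := by
          rw [Nat.div_eq_iff hD0]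
          have := Nat.div_add_mod τ D
          rw [mul_comm] at this
          constructor <;> omega
        have e2 := mod_succ_of_div_eq τ D e1
        simp only [hg, e1, e2, add_assoc]
    have hcur : g τ j = min (q (τ / D) j + τ % D) (max (q (τ / D) j) (q (τ / D + 1) j)) := rfl
    by_cases hjS : (⟨j, hjp⟩ : Fin p) ∈ S
    swap
    · left
      have ha := hS3 _ hjS
      have hc := hqv (τ / D) ⟨j, hjp⟩
      have hd := hqv (τ / D + 1) ⟨j, hjp⟩
      simp only at hc hd
      rw [ha, ← hc] at hd
      rw [hnext, hcur, hd]
      omega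
    have ha := hS2 _ hjS
    have hb := (f (τ / D + 1) ⟨j, hjp⟩).2
    have hc := hqv (τ / D) ⟨j, hjp⟩
    have hd := hqv (τ / D + 1) ⟨j, hjp⟩
    simp only at hc hd
    have hlt : q (τ / D) j < q (τ / D + 1) j := by
      rw [hc, hd]
      exact hQ2 j _ _ (by omega) hb
    by_cases hmv : q (τ / D) j + τ % D < q (τ / D + 1) j
    swap
    · left; rw [hnext, hcur]; omega
    right
    have hgj : g τ j = q (τ / D) j + τ % D := by rw [hcur]; omega
    refine ⟨by rw [hnext, hgj]; omega, ?_⟩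
    rw [hgj]
    by_cases he : τ % D = 0
    · right
      obtain ⟨⟨k, hkj, hk⟩, _⟩ := hS1 _ hjS
      refine ⟨k, Finset.mem_range.2 k.2, fun h => hkj (Fin.ext h), ?_⟩
      have hgk : g τ k = q (τ / D) k := by simp [hg, he]
      rw [hgk, he, add_zero, hqv (τ / D) k, hc]
      have hx := (hQ1 k _ (f (τ / D) k).2).2
      have hy := (hQ1 j _ (f (τ / D) ⟨j, hjp⟩).2).2
      have := hx.trans (hk.trans hy.symm)
      simpa [hv] using congrArg Fin.val this
    · left
      intro hin
      obtain ⟨a, haA, hae⟩ := Finset.mem_image.1 hin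
      have hva : v j (q (τ / D) j + τ % D) = a := Fin.ext hae.symm
      have hl2 := (hQ1 j _ (f (τ / D + 1) ⟨j, hjp⟩).2).1
      rw [← hd] at hl2
      obtain ⟨r, hr, hrx⟩ := hQ3 j (q (τ / D) j + τ % D) (by omega) (hva ▸ haA)
      have hbb := (f (τ / D) ⟨j, hjp⟩).2
      rcases le_or_gt r (f (τ / D) ⟨j, hjp⟩ : ℕ) with h | h
      · rcases h.eq_or_lt with h | h
        · rw [h] at hrx; omega
        · have := hQ2 j _ _ h hbb; omega
      · rcases (show (f (τ / D + 1) ⟨j, hjp⟩ : ℕ) ≤ r by omega).eq_or_lt with h | h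
        · rw [← h] at hrx; omega
        · have := hQ2 j _ _ h hr; omega
  have hin : (i : ℕ) < n := by omega
  have hfin := hu.2 (Finset.range p) (by simpa using hp) (A.image Fin.val)
    (by
      intro a ha
      obtain ⟨b, _, hb⟩ := Finset.mem_image.1 ha
      rw [Finset.mem_range, ← hb]; exact b.2)
    (by rw [Finset.card_image_of_injective _ Fin.val_injective, Finset.card_range]; omega)
    g (t1 * D) (t2 * D) (Nat.mul_le_mul_right _ ht) (hrun.sub (Nat.zero_le _) le_rfl) i
    (Finset.mem_range.2 i.2)
  rw [hgD, hgD, hqv, hqv] at hfin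
  obtain ⟨a, ha⟩ : A.Nonempty := Finset.card_pos.1 (by omega)
  obtain ⟨x, _, hx2, hx3⟩ := good_freq hu hin a.2 0
  obtain ⟨y, hy1, hy2, hy3⟩ := good_freq hu hin a.2 (2 * L i)
  obtain ⟨r, hr, hrx⟩ := hQ3 i x (by omega) (by rw [show v i x = a from Fin.ext hx3]; exact ha)
  obtain ⟨r', hr', hry⟩ := hQ3 i y (by omega) (by rw [show v i y = a from Fin.ext hy3]; exact ha)
  have k1 : Q i (f t1 i) ≤ x := by
    rw [hf1, ← hrx]
    rcases Nat.eq_zero_or_pos r with h | h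
    · rw [h]
    · exact (hQ2 i _ _ h hr).le
  have k2 : y ≤ Q i (f t2 i) := by
    rw [← hry]
    rcases (show r' ≤ (f t2 i : ℕ) by omega).eq_or_lt with h | h
    · rw [h]
    · exact (hQ2 i _ _ h (f t2 i).2).le
  omega

/-- Proposition on the existence of the recursive system of words: (a) full words
`s₁,…,s_n` over `2n-1` chairs such that `s₁(A),…,s_p(A)` is terminal for every `p ≤ n`
and every `A` of size `2p-1`; (b) full words `w₁,…,w_n` over `2n` chairs such that
`w₁(B),…,w_p(B)` is terminal for every `p ≤ n` and every `B` of size `2p-1`. -/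
theorem stmt_7 (n : ℕ) (hn : 1 ≤ n) :
    (∃ s : Fin n → List (Fin (2 * n - 1)),
      (∀ i, ∀ a : Fin (2 * n - 1), a ∈ s i) ∧
      ∀ (p : ℕ) (hp : p ≤ n), 1 ≤ p →
        ∀ A : Finset (Fin (2 * n - 1)), A.card = 2 * p - 1 →
          Terminal (fun j : Fin p => restrictWord (s (Fin.castLE hp j)) A)) ∧
    (∃ w : Fin n → List (Fin (2 * n)),
      (∀ i, ∀ a : Fin (2 * n), a ∈ w i) ∧
      ∀ (p : ℕ) (hp : p ≤ n), 1 ≤ p →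
        ∀ B : Finset (Fin (2 * n)), B.card = 2 * p - 1 →
          Terminal (fun j : Fin p => restrictWord (w (Fin.castLE hp j)) B)) := by
  exact ⟨final_words n (2 * n - 1) (by omega), final_words n (2 * n) (by omega)⟩
end

section
/- Let n ≥ 2 and m = 2n−2, and let τ_1,…,τ_n be infinite words over the alphabet {1,…,2n−2} such that the chair 1 occurs in both τ_1 and τ_2, and for every 3 ≤ i ≤ n the word τ_i contains both chair 2i−4 and chair 2i−3. Then τ_1,…,τ_n is a losing strategy: there exists an initial configuration from which there is an infinite run of immediate-scheduler steps. -/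
/-- A step of the immediate scheduler for infinite words: a nonempty set `S` of
players, each in conflict, has its positions increased by one; others stay put. -/
def IStep {n m : ℕ} (π : Fin n → ℕ → Fin m) (c c' : Fin n → ℕ) : Prop :=
  ∃ S : Finset (Fin n), S.Nonempty ∧
    (∀ i ∈ S, ∃ j, j ≠ i ∧ π j (c j) = π i (c i)) ∧
    (∀ i ∈ S, c' i = c i + 1) ∧
    (∀ i ∉ S, c' i = c i)

/-- Move all players of `S` one step. -/
def mvSet {n : ℕ} (c : Fin n → ℕ) (S : Finset (Fin n)) : Fin n → ℕ :=
  fun i => if i ∈ S then c i + 1 else c i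

/-- Pairing of a signed list of configurations with a function. -/
def pairing {n : ℕ} (L : List (ℤ × (Fin n → ℕ))) (h : (Fin n → ℕ) → ℤ) : ℤ :=
  (L.map (fun x => x.1 * h x.2)).sum

/-- Independence of coordinate `r`. -/
def Indep {n : ℕ} (r : Fin n) (h : (Fin n → ℕ) → ℤ) : Prop :=
  ∀ c d : Fin n → ℕ, (∀ i, i ≠ r → c i = d i) → h c = h d

/-- Subdivision of a single signed configuration along a conflict edge. -/
def subdivOne {n : ℕ} (i j : Fin n) (k l : ℕ) (x : ℤ × (Fin n → ℕ)) :
    List (ℤ × (Fin n → ℕ)) :=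
  if x.2 i = k ∧ x.2 j = l then
    [(x.1, mvSet x.2 {i}), (x.1, mvSet x.2 {j}), (-x.1, mvSet x.2 {i, j})]
  else [x]

/-- Dual of the subdivision. -/
def dualSub {n : ℕ} (i j : Fin n) (k l : ℕ) (h : (Fin n → ℕ) → ℤ) : (Fin n → ℕ) → ℤ :=
  fun c => if c i = k ∧ c j = l then
    h (mvSet c {i}) + h (mvSet c {j}) - h (mvSet c {i, j}) else h c

theorem pairing_subdiv {n : ℕ} (i j : Fin n) (k l : ℕ) (L : List (ℤ × (Fin n → ℕ)))
    (h : (Fin n → ℕ) → ℤ) :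
    pairing (L.flatMap (subdivOne i j k l)) h = pairing L (dualSub i j k l h) := by
  induction L with
  | nil => simp [pairing]
  | cons x L ih =>
    simp only [pairing, List.flatMap_cons, List.map_append, List.sum_append, List.map_cons,
      List.sum_cons] at ih ⊢
    rw [ih]
    congr 1
    unfold subdivOne dualSub
    split_ifs
    · simp; ring
    · simp

theorem dualSub_indep {n : ℕ} {i j : Fin n} (k l : ℕ) {r : Fin n} (hi : i ≠ r) (hj : j ≠ r)
    {h : (Fin n → ℕ) → ℤ} (hh : Indep r h) : Indep r (dualSub i j k l h) := by
  intro c c' hc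
  have hm : ∀ S, h (mvSet c S) = h (mvSet c' S) := by
    intro S
    apply hh
    intro t ht
    simp [mvSet, hc t ht]
  simp only [dualSub, hm, hc i hi, hc j hj, hh c c' hc]

theorem dualSub_left {n : ℕ} {i j : Fin n} (hij : i ≠ j) (k l : ℕ)
    {h : (Fin n → ℕ) → ℤ} (hh : Indep i h) : dualSub i j k l h = h := by
  funext c
  unfold dualSub
  split_ifs
  · have e1 : h (mvSet c {i}) = h c := hh _ _ (by intro t ht; simp [mvSet, ht])
    have e2 : h (mvSet c {i, j}) = h (mvSet c {j}) := hh _ _ (by intro t ht; simp [mvSet, ht])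
    rw [e1, e2]; ring
  · rfl

theorem dualSub_right {n : ℕ} {i j : Fin n} (hij : i ≠ j) (k l : ℕ)
    {h : (Fin n → ℕ) → ℤ} (hh : Indep j h) : dualSub i j k l h = h := by
  funext c
  unfold dualSub
  split_ifs
  · have e1 : h (mvSet c {j}) = h c := hh _ _ (by intro t ht; simp [mvSet, ht])
    have e2 : h (mvSet c {i, j}) = h (mvSet c {i}) := hh _ _ (by intro t ht; simp [mvSet, ht])
    rw [e1, e2]; ring
  · rfl

theorem istep_mvSet {n m : ℕ} (τ : Fin n → ℕ → Fin m) (c : Fin n → ℕ) (S : Finset (Fin n))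
    (hS : S.Nonempty) (h : ∀ i ∈ S, ∃ j, j ≠ i ∧ τ j (c j) = τ i (c i)) :
    IStep τ c (mvSet c S) :=
  ⟨S, hS, h, fun i hi => by simp [mvSet, hi], fun i hi => by simp [mvSet, hi]⟩

theorem exists_measure {n m : ℕ} (τ : Fin n → ℕ → Fin m)
    (wf : WellFounded (fun c' c : Fin n → ℕ => IStep τ c c')) :
    ∃ μ : (Fin n → ℕ) → ℕ, ∀ c S₁ S₂ S₃, IStep τ c (mvSet c S₁) → IStep τ c (mvSet c S₂) →
      IStep τ c (mvSet c S₃) → μ (mvSet c S₁) + μ (mvSet c S₂) + μ (mvSet c S₃) < μ c := by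
  classical
  let F : (c : Fin n → ℕ) → ((c' : Fin n → ℕ) → IStep τ c c' → ℕ) → ℕ :=
    fun c rec => 1 + 3 * ∑ S : Finset (Fin n),
      if h : IStep τ c (mvSet c S) then rec (mvSet c S) h else 0
  refine ⟨wf.fix F, ?_⟩
  intro c S₁ S₂ S₃ h₁ h₂ h₃
  have key : ∀ S, IStep τ c (mvSet c S) → wf.fix F (mvSet c S) ≤ ∑ S : Finset (Fin n),
      if h : IStep τ c (mvSet c S) then wf.fix F (mvSet c S) else 0 := by
    intro S hS
    have := Finset.single_le_sum (f := fun S : Finset (Fin n) =>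
      if h : IStep τ c (mvSet c S) then wf.fix F (mvSet c S) else 0) (s := Finset.univ)
      (fun _ _ => Nat.zero_le _) (Finset.mem_univ S)
    simpa [hS] using this
  have e : wf.fix F c = 1 + 3 * ∑ S : Finset (Fin n),
      if h : IStep τ c (mvSet c S) then wf.fix F (mvSet c S) else 0 := by
    rw [wf.fix_eq]
  have := key _ h₁
  have := key _ h₂
  have := key _ h₃
  omega

/-- Total measure. -/
def total {n : ℕ} (μ : (Fin n → ℕ) → ℕ) (L : List (ℤ × (Fin n → ℕ))) : ℕ :=
  (L.map (fun x => μ x.2)).sum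

theorem total_subdiv_le {n : ℕ} (μ : (Fin n → ℕ) → ℕ) (i j : Fin n) (k l : ℕ)
    (hμ : ∀ c : Fin n → ℕ, c i = k → c j = l →
      μ (mvSet c {i}) + μ (mvSet c {j}) + μ (mvSet c {i, j}) < μ c)
    (L : List (ℤ × (Fin n → ℕ))) :
    total μ (L.flatMap (subdivOne i j k l)) ≤ total μ L ∧
    ((∃ x ∈ L, x.2 i = k ∧ x.2 j = l) →
      total μ (L.flatMap (subdivOne i j k l)) < total μ L) := by
  induction L with
  | nil => simp [total]
  | cons x L ih =>
    simp only [total, List.flatMap_cons, List.map_append, List.sum_append, List.map_cons,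
      List.sum_cons] at ih ⊢
    by_cases hx : x.2 i = k ∧ x.2 j = l
    · have := hμ x.2 hx.1 hx.2
      have e : ((subdivOne i j k l x).map (fun x => μ x.2)).sum
          = μ (mvSet x.2 {i}) + μ (mvSet x.2 {j}) + μ (mvSet x.2 {i, j}) := by
        simp [subdivOne, hx, add_assoc]
      rw [e]
      constructor
      · omega
      · intro _; omega
    · have e : ((subdivOne i j k l x).map (fun x => μ x.2)).sum = μ x.2 := by
        simp [subdivOne, hx]
      rw [e]
      refine ⟨by omega, ?_⟩
      rintro ⟨y, hy, hy'⟩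
      rcases List.mem_cons.1 hy with rfl | hy
      · exact absurd hy' hx
      · have := ih.2 ⟨y, hy, hy'⟩
        omega

/-- Sign of a chair. -/
def csign (x : ℕ) : ℤ := if x % 2 = 1 then 1 else -1

/-- Pair of a chair. -/
def cpair (n x : ℕ) : ℕ := if x = 2 * n - 3 then 0 else (x + 1) / 2

open Classical in
/-- The cochain. -/
noncomputable def fco {n : ℕ} (r : Fin n) (x : Fin n → ℕ) : ℤ :=
  if Set.InjOn (fun i => cpair n (x i)) {i | i ≠ r} then
    ∏ i ∈ Finset.univ.erase r, csign (x i) else 0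

theorem fco_congr {n : ℕ} (r : Fin n) (x y : Fin n → ℕ) (h : ∀ i, i ≠ r → x i = y i) :
    fco r x = fco r y := by
  unfold fco
  have e1 : Set.InjOn (fun i => cpair n (x i)) {i | i ≠ r} ↔
      Set.InjOn (fun i => cpair n (y i)) {i | i ≠ r} :=
    Set.EqOn.injOn_iff (fun i hi => by simp [h i hi])
  have e2 : ∏ i ∈ Finset.univ.erase r, csign (x i) = ∏ i ∈ Finset.univ.erase r, csign (y i) :=
    Finset.prod_congr rfl (fun i hi => by rw [h i (Finset.ne_of_mem_erase hi)])
  classical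
  rw [e2]
  exact if_congr e1 rfl rfl

theorem fco_sum {n : ℕ} (hn : 2 ≤ n) (x : Fin n → ℕ) (hx : ∀ i, x i < 2 * n - 2)
    (hinj : Function.Injective x) : ∑ r, fco r x = 0 := by
  obtain ⟨i, -, j, -, hij, hp⟩ := Finset.exists_ne_map_eq_of_card_lt_of_maps_to
    (s := (Finset.univ : Finset (Fin n))) (t := Finset.range (n - 1))
    (f := fun i => cpair n (x i)) (by simp; omega) (by
      intro i _
      have := hx i
      simp only [cpair, Finset.coe_range, Set.mem_Iio]
      split_ifs <;> omega)
  have hne : x i ≠ x j := fun h => hij (hinj h)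
  have hs : csign (x i) = - csign (x j) := by
    have := hx i
    have := hx j
    simp only [cpair] at hp
    simp only [csign]
    split_ifs at hp ⊢ <;> first | omega | norm_num
  rw [← Finset.sum_subset (Finset.subset_univ {i, j})]
  · rw [Finset.sum_pair hij]
    have e1 : Set.InjOn (fun i => cpair n (x i)) {t | t ≠ i} ↔
        Set.InjOn (fun i => cpair n (x i)) {t | t ≠ j} := by
      simp only [Set.InjOn, Set.mem_ofPred_eq] at hp ⊢
      constructor
      · intro h a ha b hb hab
        by_cases ha' : a = i
        · by_cases hb' : b = i
          · rw [ha', hb']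
          · exact absurd (h (Ne.symm hij) hb' (by rw [← hp, ← hab, ha'])) (Ne.symm hb)
        · by_cases hb' : b = i
          · exact absurd (h ha' (Ne.symm hij) (by rw [hab, hb', hp])) ha
          · exact h ha' hb' hab
      · intro h a ha b hb hab
        by_cases ha' : a = j
        · by_cases hb' : b = j
          · rw [ha', hb']
          · exact absurd (h hij hb' (by rw [hp, ← hab, ha'])) (Ne.symm hb)
        · by_cases hb' : b = j
          · exact absurd (h ha' hij (by rw [hab, hb', hp])) ha
          · exact h ha' hb' hab
    unfold fco
    classical
    rw [if_congr e1 rfl rfl]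
    split_ifs
    · rw [← Finset.mul_prod_erase (Finset.univ.erase i) (fun t => csign (x t)) (a := j)
        (by simp [Ne.symm hij]),
        ← Finset.mul_prod_erase (Finset.univ.erase j) (fun t => csign (x t)) (a := i)
        (by simp [hij]), Finset.erase_right_comm, hs]
      ring
    · simp
  · intro r _ hr
    simp only [Finset.mem_insert, Finset.mem_singleton, not_or] at hr
    unfold fco
    rw [if_neg]
    intro h
    exact hij (h (Ne.symm hr.1) (Ne.symm hr.2) hp)

/-- Sign of a choice. -/
def esign {n : ℕ} (ε : Fin n → Bool) : ℤ :=
  ∏ i : Fin n, if 2 ≤ (i : ℕ) then (if ε i then 1 else -1) else 1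

/-- Configuration of a choice. -/
def cfg {n : ℕ} (p q : Fin n → ℕ) (ε : Fin n → Bool) : Fin n → ℕ :=
  fun i => if ε i then p i else q i

/-- The initial chain. -/
noncomputable def chain0 {n : ℕ} (p q : Fin n → ℕ) : List (ℤ × (Fin n → ℕ)) :=
  (Finset.univ : Finset (Fin n → Bool)).toList.map (fun ε => (esign ε, cfg p q ε))

theorem pairing_chain0 {n : ℕ} (p q : Fin n → ℕ) (h : (Fin n → ℕ) → ℤ) :
    pairing (chain0 p q) h = ∑ ε : Fin n → Bool, esign ε * h (cfg p q ε) := by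
  simp only [pairing, chain0, List.map_map]
  rw [← Finset.sum_map_toList]
  rfl

theorem esign_flip {n : ℕ} (r : Fin n) (hr : 2 ≤ (r : ℕ)) (ε : Fin n → Bool) :
    esign (Function.update ε r (!ε r)) = - esign ε := by
  unfold esign
  rw [← Finset.mul_prod_erase _ _ (Finset.mem_univ r),
    ← Finset.mul_prod_erase _ (fun i : Fin n => if 2 ≤ (i : ℕ) then (if ε i then (1 : ℤ) else -1)
      else 1) (Finset.mem_univ r)]
  have : ∏ i ∈ Finset.univ.erase r, (if 2 ≤ (i : ℕ) then
      (if Function.update ε r (!ε r) i then (1 : ℤ) else -1) else 1)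
      = ∏ i ∈ Finset.univ.erase r, (if 2 ≤ (i : ℕ) then (if ε i then (1 : ℤ) else -1) else 1) :=
    Finset.prod_congr rfl (fun i hi => by
      rw [Function.update_of_ne (Finset.ne_of_mem_erase hi)])
  rw [this]
  cases h : ε r <;> simp [hr]

theorem chain0_kill {n : ℕ} (p q : Fin n → ℕ) (r : Fin n) (hr : 2 ≤ (r : ℕ))
    (h : (Fin n → ℕ) → ℤ) (hh : Indep r h) : pairing (chain0 p q) h = 0 := by
  rw [pairing_chain0]
  have hc : ∀ ε : Fin n → Bool, h (cfg p q (Function.update ε r (!ε r))) = h (cfg p q ε) := by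
    intro ε
    apply hh
    intro i hi
    simp [cfg, hi]
  refine Finset.sum_involution (fun ε _ => Function.update ε r (!ε r)) ?_ ?_ ?_ ?_
  · intro ε _
    rw [esign_flip r hr, hc]; ring
  · intro ε _ _ he
    have := congrFun he r
    simp at this
  · simp
  · intro ε _
    simp

/-- Proposition: with `m = 2n-2` chairs (0-indexed, so chair `c` of `{1,…,2n-2}` is
`c - 1` of `Fin (2n-2)`, and player `i` of `{1,…,n}` is `i - 1` of `Fin n`), any team
strategy in which chair `1` (index `0`) occurs in the words of players `1` and `2`
(indices `0,1`) and, for `3 ≤ i ≤ n`, the word of player `i` contains chairs `2i-4` and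
`2i-3` (indices `2i-5` and `2i-4`, i.e. `2p-3` and `2p-2` for `p = i-1`), is losing:
the scheduler has an infinite run from some initial configuration. -/
theorem stmt_8 (n : ℕ) (hn : 2 ≤ n) (τ : Fin n → ℕ → Fin (2 * n - 2))
    (h1 : ∃ k, (τ ⟨0, by omega⟩ k : ℕ) = 0)
    (h2 : ∃ k, (τ ⟨1, by omega⟩ k : ℕ) = 0)
    (h3 : ∀ i : Fin n, 2 ≤ (i : ℕ) →
      (∃ k, (τ i k : ℕ) = 2 * (i : ℕ) - 3) ∧ (∃ k, (τ i k : ℕ) = 2 * (i : ℕ) - 2)) :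
    ∃ f : ℕ → (Fin n → ℕ), ∀ t, IStep τ (f t) (f (t + 1)) := by
  classical
  by_contra hno
  have wf : WellFounded (fun c' c : Fin n → ℕ => IStep τ c c') := by
    rw [wellFounded_iff_isEmpty_descending_chain]
    exact ⟨fun f => hno ⟨f.1, f.2⟩⟩
  obtain ⟨μ, hμ⟩ := exists_measure τ wf
  have hp : ∀ i : Fin n, ∃ k, (τ i k : ℕ) = if 2 ≤ (i : ℕ) then 2 * (i : ℕ) - 3 else 0 := by
    intro i
    split_ifs with hi
    · exact (h3 i hi).1
    · rcases i with ⟨_ | _ | i, hi'⟩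
      · exact h1
      · exact h2
      · simp at hi
  have hq : ∀ i : Fin n, ∃ k, (τ i k : ℕ) = if 2 ≤ (i : ℕ) then 2 * (i : ℕ) - 2 else 0 := by
    intro i
    split_ifs with hi
    · exact (h3 i hi).2
    · rcases i with ⟨_ | _ | i, hi'⟩
      · exact h1
      · exact h2
      · simp at hi
  choose p hp using hp
  choose q hq using hq
  have hcfg : ∀ ε i, (τ i (cfg p q ε i) : ℕ) =
      if 2 ≤ (i : ℕ) then (if ε i then 2 * (i : ℕ) - 3 else 2 * (i : ℕ) - 2) else 0 := by
    intro ε i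
    unfold cfg
    cases ε i
    · simpa using hq i
    · simpa using hp i
  have hconf : ∀ ε (i j : Fin n), i ≠ j → τ i (cfg p q ε i) = τ j (cfg p q ε j) →
      (i : ℕ) < 2 ∧ (j : ℕ) < 2 := by
    intro ε i j hij h
    have h' := congrArg Fin.val h
    rw [hcfg, hcfg] at h'
    have : (i : ℕ) ≠ j := fun h => hij (Fin.ext h)
    split_ifs at h' <;> omega
  have main : ∀ N (L : List (ℤ × (Fin n → ℕ))), total μ L = N →
      (∀ r h, Indep r h → pairing L h = pairing (chain0 p q) h) → False := by
    intro N
    induction N using Nat.strong_induction_on with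
    | _ N ih =>
    intro L hL hP
    by_cases hc : ∃ x ∈ L, ∃ i j : Fin n, i ≠ j ∧ τ i (x.2 i) = τ j (x.2 j)
    · obtain ⟨x, hx, i, j, hij, hτ⟩ := hc
      have hdec := total_subdiv_le μ i j (x.2 i) (x.2 j) (by
        intro c hci hcj
        have hτ' : τ i (c i) = τ j (c j) := by rw [hci, hcj, hτ]
        apply hμ
        · apply istep_mvSet
          · simp
          · simp only [Finset.mem_singleton, forall_eq]
            exact ⟨j, Ne.symm hij, hτ'.symm⟩
        · apply istep_mvSet
          · simp
          · simp only [Finset.mem_singleton, forall_eq]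
            exact ⟨i, hij, hτ'⟩
        · apply istep_mvSet
          · simp
          · simp only [Finset.mem_insert, Finset.mem_singleton, forall_eq_or_imp, forall_eq]
            exact ⟨⟨j, Ne.symm hij, hτ'.symm⟩, ⟨i, hij, hτ'⟩⟩) L
      refine ih _ (hL ▸ hdec.2 ⟨x, hx, rfl, rfl⟩) _ rfl ?_
      intro r h hh
      rw [pairing_subdiv]
      by_cases hri : i = r
      · subst hri
        rw [dualSub_left hij _ _ hh]
        exact hP _ _ hh
      by_cases hrj : j = r
      · subst hrj
        rw [dualSub_right hij _ _ hh]
        exact hP _ _ hh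
      have hd := dualSub_indep (x.2 i) (x.2 j) hri hrj hh
      rw [hP r _ hd]
      by_cases hr : 2 ≤ (r : ℕ)
      · rw [chain0_kill p q r hr _ hd, chain0_kill p q r hr _ hh]
      · rw [pairing_chain0, pairing_chain0]
        refine Finset.sum_congr rfl (fun ε _ => ?_)
        unfold dualSub
        rw [if_neg]
        rintro ⟨e1, e2⟩
        have := hconf ε i j hij (by rw [e1, e2, hτ])
        have a1 : (i : ℕ) ≠ j := fun h => hij (Fin.ext h)
        have a2 : (i : ℕ) ≠ r := fun h => hri (Fin.ext h)
        have a3 : (j : ℕ) ≠ r := fun h => hrj (Fin.ext h)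
        omega
    · push Not at hc
      let g : Fin n → (Fin n → ℕ) → ℤ := fun r c => fco r (fun i => (τ i (c i) : ℕ))
      have hg : ∀ r, Indep r (g r) := by
        intro r c c' h
        apply fco_congr
        intro i hi
        simp only [h i hi]
      have hlin : ∀ M : List (ℤ × (Fin n → ℕ)),
          ∑ r, pairing M (g r) = pairing M (fun c => ∑ r, g r c) := by
        intro M
        induction M with
        | nil => simp [pairing]
        | cons y M ihM =>
          simp only [pairing, List.map_cons, List.sum_cons] at ihM ⊢
          rw [Finset.sum_add_distrib, ihM, Finset.mul_sum]
      have hzero : ∑ r, pairing L (g r) = 0 := by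
        rw [hlin]
        unfold pairing
        apply List.sum_eq_zero
        intro z hz
        obtain ⟨y, hy, rfl⟩ := List.mem_map.1 hz
        simp only [g]
        rw [fco_sum hn, mul_zero]
        · intro i; exact (τ i (y.2 i)).2
        · intro i j h
          by_contra hij
          exact hc y hy i j hij (Fin.ext h)
      have hval : ∀ r : Fin n, pairing L (g r) = if 2 ≤ (r : ℕ) then 0 else -(2 : ℤ) ^ n := by
        intro r
        rw [hP r _ (hg r)]
        split_ifs with hr
        · exact chain0_kill p q r hr _ (hg r)
        · rw [pairing_chain0]
          have : ∀ ε : Fin n → Bool, esign ε * g r (cfg p q ε) = -1 := by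
            intro ε
            simp only [g, fco, hcfg]
            rw [if_pos]
            · unfold esign
              obtain ⟨s, hs, hsr⟩ : ∃ s : Fin n, (s : ℕ) < 2 ∧ s ≠ r := by
                by_cases h0 : (r : ℕ) = 0
                · exact ⟨⟨1, by omega⟩, by simp, fun h => by simp [← h] at h0⟩
                · exact ⟨⟨0, by omega⟩, by simp, fun h => by simp [← h] at h0⟩
              rw [← Finset.mul_prod_erase Finset.univ _ (Finset.mem_univ r), if_neg hr, one_mul,
                ← Finset.prod_mul_distrib, ← Finset.mul_prod_erase _ _
                  (Finset.mem_erase.2 ⟨hsr, Finset.mem_univ s⟩), Finset.prod_eq_one]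
              · simp [not_le.2 hs, csign]
              · intro t ht
                have t1 : (t : ℕ) ≠ s := fun h => (Finset.ne_of_mem_erase ht) (Fin.ext h)
                have t2 : (t : ℕ) ≠ r := fun h =>
                  (Finset.ne_of_mem_erase (Finset.mem_of_mem_erase ht)) (Fin.ext h)
                have t3 : 2 ≤ (t : ℕ) := by omega
                cases ε t
                · have : (2 * (t : ℕ) - 2) % 2 ≠ 1 := by omega
                  simp [t3, csign, this]
                · have : (2 * (t : ℕ) - 3) % 2 = 1 := by omega
                  simp [t3, csign, this]
            · intro a ha b hb hab
              have a1 : (a : ℕ) ≠ r := fun h => ha (Fin.ext h)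
              have b1 : (b : ℕ) ≠ r := fun h => hb (Fin.ext h)
              have a2 := a.2
              have b2 := b.2
              apply Fin.ext
              simp only [cpair] at hab
              split_ifs at hab <;> omega
          rw [Finset.sum_congr rfl (fun ε _ => this ε)]
          simp
      rw [Finset.sum_congr rfl (fun r _ => hval r)] at hzero
      have hle : ∑ r : Fin n, (if 2 ≤ (r : ℕ) then (0 : ℤ) else -(2 : ℤ) ^ n) < 0 := by
        apply Finset.sum_neg'
        · intro r _
          split_ifs
          · exact le_refl _
          · have : (0 : ℤ) < 2 ^ n := by positivity
            linarith
        · refine ⟨⟨0, by omega⟩, Finset.mem_univ _, ?_⟩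
          simp
      omega
  exact main _ _ rfl (fun _ _ _ => rfl)
end

section
/- Let n ≥ 2, N = 2n−2, and let π_1,…,π_N be infinite words over the alphabet {1,…,2n−2} such that π_1(0) = π_2(0) and this is the only coincidence among the first letters, i.e., π_i(0) ≠ π_j(0) for every pair i < j with (i,j) ≠ (1,2). Then for every partition of the words π_3,…,π_N into n−2 pairs, there is a choice of one word from each pair such that the n words consisting of π_1, π_2 and the n−2 chosen words admit an infinite run of immediate-scheduler steps starting from the configuration in which every player is at position 0 of its word. -/
/-- A step of the immediate scheduler in the subgame played by the players of `S`:
a nonempty set `T ⊆ S` of players, each in conflict with another player of `S`,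
has its positions increased by one; all other players stay put. -/
def SubStep {N m : ℕ} (π : Fin N → ℕ → Fin m) (S : Finset (Fin N))
    (c c' : Fin N → ℕ) : Prop :=
  ∃ T : Finset (Fin N), T ⊆ S ∧ T.Nonempty ∧
    (∀ i ∈ T, ∃ j ∈ S, j ≠ i ∧ π j (c j) = π i (c i)) ∧
    (∀ i ∈ T, c' i = c i + 1) ∧
    (∀ i ∉ T, c' i = c i)

namespace MusicalChairs

/-- Advance the players of `T`. -/
def adv {N : ℕ} (c : Fin N → ℕ) (T : Finset (Fin N)) : Fin N → ℕ :=
  fun i => if i ∈ T then c i + 1 else c i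

/-- The players of `U` in conflict. -/
def conf {N m : ℕ} (π : Fin N → ℕ → Fin m) (U : Finset (Fin N)) (c : Fin N → ℕ) :
    Finset (Fin N) :=
  U.filter (fun i => ∃ j ∈ U, j ≠ i ∧ π j (c j) = π i (c i))

/-- Forget the positions outside `U`. -/
def mask {N : ℕ} (U : Finset (Fin N)) (c : Fin N → ℕ) : Fin N → ℕ :=
  fun i => if i ∈ U then c i else 0

/-- The reversed step relation. -/
def R {N m : ℕ} (π : Fin N → ℕ → Fin m) (U : Finset (Fin N)) (c' c : Fin N → ℕ) : Prop :=
  SubStep π U c c'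

theorem conf_congr {N m : ℕ} (π : Fin N → ℕ → Fin m) (U : Finset (Fin N)) (c c' : Fin N → ℕ)
    (h : ∀ i ∈ U, c i = c' i) : conf π U c = conf π U c' := by
  ext i
  simp only [conf, Finset.mem_filter]
  constructor
  · rintro ⟨hi, j, hj, hne, he⟩
    exact ⟨hi, j, hj, hne, by rw [← h i hi, ← h j hj, he]⟩
  · rintro ⟨hi, j, hj, hne, he⟩
    exact ⟨hi, j, hj, hne, by rw [h i hi, h j hj, he]⟩

theorem R_adv {N m : ℕ} (π : Fin N → ℕ → Fin m) (U : Finset (Fin N)) (c : Fin N → ℕ)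
    (T : Finset (Fin N)) (hT : T ⊆ conf π U c) (hne : T.Nonempty) : R π U (adv c T) c := by
  refine ⟨T, hT.trans (Finset.filter_subset _ _), hne, ?_, ?_, ?_⟩
  · intro i hi
    exact (Finset.mem_filter.1 (hT hi)).2
  · intro i hi; simp [adv, hi]
  · intro i hi; simp [adv, hi]

theorem R_exists {N m : ℕ} (π : Fin N → ℕ → Fin m) (U : Finset (Fin N)) (c c' : Fin N → ℕ)
    (h : R π U c' c) : ∃ T, T ⊆ conf π U c ∧ T.Nonempty ∧ c' = adv c T := by
  obtain ⟨T, h1, h2, h3, h4, h5⟩ := h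
  refine ⟨T, fun i hi => Finset.mem_filter.2 ⟨h1 hi, h3 i hi⟩, h2, ?_⟩
  funext i
  by_cases hi : i ∈ T
  · simp [adv, hi, h4]
  · simp [adv, hi, h5]

theorem R_mono {N m : ℕ} (π : Fin N → ℕ → Fin m) {U V : Finset (Fin N)} (hUV : U ⊆ V)
    (c c' : Fin N → ℕ) (h : R π U c' c) : R π V c' c := by
  obtain ⟨T, h1, h2, h3, h4, h5⟩ := h
  refine ⟨T, h1.trans hUV, h2, ?_, h4, h5⟩
  intro i hi
  obtain ⟨j, hj, h⟩ := h3 i hi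
  exact ⟨j, hUV hj, h⟩

theorem acc_local {N m : ℕ} (π : Fin N → ℕ → Fin m) (U : Finset (Fin N)) (c : Fin N → ℕ)
    (hc : Acc (R π U) c) : ∀ c', (∀ i ∈ U, c i = c' i) → Acc (R π U) c' := by
  induction hc with
  | intro c _ ih =>
    intro c' h
    constructor
    intro d hd
    obtain ⟨T, hT, hne, rfl⟩ := R_exists π U _ _ hd
    rw [← conf_congr π U c c' h] at hT
    refine ih _ (R_adv π U c T hT hne) _ ?_
    intro i hi
    simp [adv, h i hi]

theorem mask_adv {N : ℕ} (U : Finset (Fin N)) (c : Fin N → ℕ) (T : Finset (Fin N))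
    (hT : T ⊆ U) : mask U (adv c T) = adv (mask U c) T := by
  funext i
  by_cases hi : i ∈ U
  · simp [mask, adv, hi]
  · have : i ∉ T := fun h => hi (hT h)
    simp [mask, adv, hi, this]

theorem exists_Phi0 {N m : ℕ} (π : Fin N → ℕ → Fin m) (U : Finset (Fin N))
    (g : (Fin N → ℕ) → ℤ) :
    ∃ Φ : (Fin N → ℕ) → ℤ, ∀ c, Acc (R π U) c →
      (conf π U c = ∅ → Φ c = g c) ∧
      (conf π U c ≠ ∅ →
        Φ c = - ∑ T ∈ (conf π U c).powerset.erase ∅, (-1) ^ T.card * Φ (adv c T)) := by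
  classical
  let r : (Fin N → ℕ) → (Fin N → ℕ) → Prop := fun c' c => Acc (R π U) c ∧ R π U c' c
  have hwf : WellFounded r := by
    constructor
    intro c
    by_cases hc : Acc (R π U) c
    · induction hc with
      | intro c _ ih => exact ⟨c, fun d hd => ih d hd.2⟩
    · exact ⟨c, fun d hd => absurd hd.1 hc⟩
  let F : (c : Fin N → ℕ) → ((c' : Fin N → ℕ) → r c' c → ℤ) → ℤ := fun c rec =>
    if conf π U c = ∅ then g c else
      - ∑ T ∈ (conf π U c).powerset.erase ∅, (-1) ^ T.card *
        (if h : r (adv c T) c then rec _ h else 0)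
  refine ⟨hwf.fix F, fun c hc => ⟨fun h => ?_, fun h => ?_⟩⟩
  · rw [hwf.fix_eq]; simp [F, h]
  · rw [hwf.fix_eq]
    simp only [F, if_neg h]
    congr 1
    apply Finset.sum_congr rfl
    intro T hT
    rw [Finset.mem_erase, Finset.mem_powerset] at hT
    rw [dif_pos ⟨hc, R_adv π U c T hT.2 (Finset.nonempty_iff_ne_empty.2 hT.1)⟩]

theorem exists_Phi {N m : ℕ} (π : Fin N → ℕ → Fin m) (U : Finset (Fin N))
    (g : Finset (Fin m) → ℤ) :
    ∃ Φ : (Fin N → ℕ) → ℤ,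
      (∀ c c', (∀ i ∈ U, c i = c' i) → Φ c = Φ c') ∧
      ∀ c, Acc (R π U) c →
      (conf π U c = ∅ → Φ c = g (U.image (fun i => π i (c i)))) ∧
      (conf π U c ≠ ∅ →
        ∑ T ∈ (conf π U c).powerset, (-1) ^ T.card * Φ (adv c T) = 0) := by
  classical
  obtain ⟨Φ, hΦ⟩ := exists_Phi0 π U (fun c => g (U.image (fun i => π i (c i))))
  have hm : ∀ c : Fin N → ℕ, ∀ i ∈ U, c i = mask U c i := by
    intro c i hi; simp [mask, hi]
  refine ⟨fun c => Φ (mask U c), ?_, ?_⟩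
  · intro c c' h
    have : mask U c = mask U c' := by
      funext i
      by_cases hi : i ∈ U
      · simp [mask, hi, h i hi]
      · simp [mask, hi]
    simp only [this]
  · intro c hc
    have hacc := acc_local π U c hc (mask U c) (hm c)
    obtain ⟨h1, h2⟩ := hΦ _ hacc
    have hconf := conf_congr π U c (mask U c) (hm c)
    rw [← hconf] at h1 h2
    refine ⟨fun h => ?_, fun h => ?_⟩
    · show Φ (mask U c) = _
      rw [h1 h]
      congr 1
      apply Finset.image_congr
      intro i hi
      simp only [← hm c i hi]
    · rw [← Finset.add_sum_erase _ _ (Finset.empty_mem_powerset _)]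
      have h0 : adv c ∅ = c := by funext i; simp [adv]
      rw [h0]
      simp only [Finset.card_empty, pow_zero, one_mul]
      rw [h2 h]
      rw [neg_add_eq_zero]
      apply Finset.sum_congr rfl
      intro T hT
      rw [Finset.mem_erase, Finset.mem_powerset] at hT
      rw [mask_adv U c T (hT.2.trans (Finset.filter_subset _ _))]

theorem cocycle {N m : ℕ} (π : Fin N → ℕ → Fin m) (g : Finset (Fin m) → ℤ) (n : ℕ)
    (hg : ∀ B : Finset (Fin m), B.card = n → ∑ b ∈ B, g (B.erase b) = 0)
    (Φ : Finset (Fin N) → (Fin N → ℕ) → ℤ)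
    (hloc : ∀ U c c', (∀ i ∈ U, c i = c' i) → Φ U c = Φ U c')
    (hΦ : ∀ U c, Acc (R π U) c →
      (conf π U c = ∅ → Φ U c = g (U.image (fun i => π i (c i)))) ∧
      (conf π U c ≠ ∅ →
        ∑ T ∈ (conf π U c).powerset, (-1) ^ T.card * Φ U (adv c T) = 0))
    (S : Finset (Fin N)) (hS : S.card = n) (c : Fin N → ℕ) (hc : Acc (R π S) c) :
    ∑ i ∈ S, Φ (S.erase i) c = 0 := by
  classical
  induction hc with
  | intro c hc ih =>
  have hacc : Acc (R π S) c := ⟨c, hc⟩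
  have hacc' : ∀ i, Acc (R π (S.erase i)) c := fun i =>
    Subrelation.accessible (fun h => R_mono π (Finset.erase_subset i S) _ _ h) hacc
  have hconf : ∀ i ∈ S, i ∉ conf π S c → conf π (S.erase i) c = conf π S c := by
    intro i hi hic
    ext j
    simp only [conf, Finset.mem_filter, Finset.mem_erase, not_and, not_exists] at hic ⊢
    constructor
    · rintro ⟨⟨h1, h2⟩, k, ⟨h3, h4⟩, h5, h6⟩
      exact ⟨h2, k, h4, h5, h6⟩
    · rintro ⟨h2, k, h4, h5, h6⟩
      refine ⟨⟨?_, h2⟩, k, ⟨?_, h4⟩, h5, h6⟩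
      · rintro rfl; exact hic hi k h4 h5 h6
      · rintro rfl; exact hic hi j h2 h5.symm h6.symm
  by_cases h0 : conf π S c = ∅
  · have hinj : Set.InjOn (fun i => π i (c i)) (S : Set (Fin N)) := by
      intro i hi j hj hij
      by_contra hne
      have : j ∈ conf π S c := Finset.mem_filter.2 ⟨hj, i, hi, hne, hij⟩
      rw [h0] at this
      simp at this
    have := hg (S.image (fun i => π i (c i))) (by rw [Finset.card_image_of_injOn hinj, hS])
    rw [Finset.sum_image hinj] at this
    rw [← this]
    apply Finset.sum_congr rfl
    intro i hi
    rw [(hΦ _ c (hacc' i)).1 (by rw [hconf i hi (by simp [h0]), h0])]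
    congr 1
    ext b
    simp only [Finset.mem_image, Finset.mem_erase]
    constructor
    · rintro ⟨j, ⟨h1, h2⟩, rfl⟩
      exact ⟨fun h => h1 (hinj h2 hi h), j, h2, rfl⟩
    · rintro ⟨h1, j, h2, rfl⟩
      exact ⟨j, ⟨fun h => h1 (by rw [h]), h2⟩, rfl⟩
  · have key : ∀ i ∈ S,
        ∑ T ∈ (conf π S c).powerset, (-1) ^ T.card * Φ (S.erase i) (adv c T) = 0 := by
      intro i hi
      by_cases hic : i ∈ conf π S c
      · rw [← Finset.insert_erase hic, Finset.sum_powerset_insert (Finset.notMem_erase _ _),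
          ← Finset.sum_add_distrib]
        apply Finset.sum_eq_zero
        intro T hT
        have hiT : i ∉ T := fun h =>
          Finset.notMem_erase i _ (Finset.mem_powerset.1 hT h)
        rw [Finset.card_insert_of_notMem hiT,
          hloc (S.erase i) (adv c (insert i T)) (adv c T) ?_]
        · ring
        · intro j hj
          have := Finset.ne_of_mem_erase hj
          simp [adv, this]
      · have := (hΦ _ c (hacc' i)).2
        rw [hconf i hi hic] at this
        exact this h0
    have tot : ∑ T ∈ (conf π S c).powerset,
        (-1) ^ T.card * ∑ i ∈ S, Φ (S.erase i) (adv c T) = 0 := by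
      simp only [Finset.mul_sum]
      rw [Finset.sum_comm]
      exact Finset.sum_eq_zero key
    rw [← Finset.add_sum_erase _ _ (Finset.empty_mem_powerset _)] at tot
    have he : adv c ∅ = c := by funext i; simp [adv]
    rw [he, Finset.sum_eq_zero (s := (conf π S c).powerset.erase ∅)] at tot
    · simpa using tot
    · intro T hT
      rw [Finset.mem_erase, Finset.mem_powerset] at hT
      rw [ih _ (R_adv π S c T hT.2 (Finset.nonempty_iff_ne_empty.2 hT.1)), mul_zero]

/-- The Specht-type cochain. -/
def gfun {m : ℕ} {κ : Type} [Fintype κ] (h : κ × Fin 2 ≃ Fin m) (A : Finset (Fin m)) : ℤ :=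
  ∏ k, ((if h (k, 0) ∈ A then 1 else 0) - (if h (k, 1) ∈ A then 1 else 0))

theorem gfun_cocycle {m : ℕ} {κ : Type} [Fintype κ] (h : κ × Fin 2 ≃ Fin m)
    (B : Finset (Fin m)) (hB : B.card = Fintype.card κ + 1) :
    ∑ b ∈ B, gfun h (B.erase b) = 0 := by
  classical
  obtain ⟨x, hx, y, hy, hxy, hk⟩ := Finset.exists_ne_map_eq_of_card_lt_of_maps_to
    (s := B) (t := (Finset.univ : Finset κ)) (f := fun b => (h.symm b).1)
    (by rw [hB, Finset.card_univ]; omega) (by intro a _; simp)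
  obtain ⟨k, h0, h1⟩ : ∃ k, h (k, 0) ∈ B ∧ h (k, 1) ∈ B := by
    obtain ⟨⟨a, s⟩, rfl⟩ := h.surjective x
    obtain ⟨⟨b, t⟩, rfl⟩ := h.surjective y
    simp only [Equiv.symm_apply_apply] at hk
    subst hk
    refine ⟨a, ?_⟩
    fin_cases s <;> fin_cases t <;> simp_all
  have hne : h (k, 0) ≠ h (k, 1) := by simp
  have hz : ∑ b ∈ (B.erase (h (k, 0))).erase (h (k, 1)), gfun h (B.erase b) = 0 := by
    apply Finset.sum_eq_zero
    intro b hb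
    simp only [Finset.mem_erase] at hb
    apply Finset.prod_eq_zero (Finset.mem_univ k)
    simp [Finset.mem_erase, h0, h1, Ne.symm hb.1, Ne.symm hb.2.1]
  rw [← Finset.add_sum_erase _ _ h0,
    ← Finset.add_sum_erase _ _ (Finset.mem_erase.2 ⟨hne.symm, h1⟩), hz]
  unfold gfun
  rw [← Finset.mul_prod_erase _ _ (Finset.mem_univ k),
    ← Finset.mul_prod_erase (a := k) _ (fun j => ((if h (j, 0) ∈ B.erase (h (k, 1)) then (1:ℤ) else 0)
      - (if h (j, 1) ∈ B.erase (h (k, 1)) then 1 else 0))) (Finset.mem_univ k)]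
  have : ∀ s : Fin 2, ∏ x ∈ Finset.univ.erase k,
      ((if h (x, 0) ∈ B.erase (h (k, s)) then (1:ℤ) else 0)
      - (if h (x, 1) ∈ B.erase (h (k, s)) then 1 else 0)) = ∏ x ∈ Finset.univ.erase k,
      ((if h (x, 0) ∈ B then (1:ℤ) else 0) - (if h (x, 1) ∈ B then 1 else 0)) := by
    intro s
    apply Finset.prod_congr rfl
    intro x hx
    have := Finset.ne_of_mem_erase hx
    simp [Finset.mem_erase, this]
  rw [this 0, this 1]
  simp [h0, h1]

/-- The sign of a choice. -/
def sgn {k : ℕ} (ch : Fin k → Fin 2) : ℤ := ∏ q, (if ch q = 0 then 1 else -1)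

theorem sgn_mul_self {k : ℕ} (ch : Fin k → Fin 2) : sgn ch * sgn ch = 1 := by
  unfold sgn
  rw [← Finset.prod_mul_distrib]
  apply Finset.prod_eq_one
  intro q _
  split_ifs <;> simp

theorem sgn_update {k : ℕ} (ch : Fin k → Fin 2) (q : Fin k) :
    sgn (Function.update ch q (ch q + 1)) = - sgn ch := by
  unfold sgn
  rw [← Finset.mul_prod_erase _ _ (Finset.mem_univ q),
    ← Finset.mul_prod_erase _ (fun q => if ch q = 0 then (1:ℤ) else -1) (Finset.mem_univ q)]
  rw [← neg_mul]
  congr 1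
  · have : ∀ s : Fin 2, (if s + 1 = 0 then (1:ℤ) else -1) = - (if s = 0 then 1 else -1) := by
      decide
    simpa using this (ch q)
  · apply Finset.prod_congr rfl
    intro x hx
    simp [Finset.ne_of_mem_erase hx]

theorem final {N m k : ℕ} (π : Fin N → ℕ → Fin m) (p0 p1 : Fin N) (hp : p0 ≠ p1)
    (e : Fin k × Fin 2 → Fin N) (he : Function.Injective e)
    (he0 : ∀ q, e q ≠ p0) (he1 : ∀ q, e q ≠ p1)
    (h : Option (Fin k) × Fin 2 ≃ Fin m)
    (h0 : π p0 0 = h (none, 0)) (h1 : π p1 0 = h (none, 0))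
    (hs : ∀ q s, π (e (q, s)) 0 = h (some q, s))
    (hacc : ∀ ch : Fin k → Fin 2, Acc (R π (insert p0 (insert p1
      (Finset.image (fun q : Fin k => e (q, ch q)) Finset.univ)))) (fun _ => 0)) : False := by
  classical
  choose Φ hloc hΦ using fun U => exists_Phi π U (gfun h)
  have hes : ∀ ch : Fin k → Fin 2, Function.Injective (fun q : Fin k => e (q, ch q)) := by
    intro ch q q' hq
    have := he hq
    simp only [Prod.mk.injEq] at this
    exact this.1
  have m0 : ∀ ch : Fin k → Fin 2, p0 ∉ Finset.image (fun q : Fin k => e (q, ch q)) Finset.univ := by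
    intro ch; simp [he0]
  have m1 : ∀ ch : Fin k → Fin 2, p1 ∉ Finset.image (fun q : Fin k => e (q, ch q)) Finset.univ := by
    intro ch; simp [he1]
  have m01 : ∀ ch : Fin k → Fin 2,
      p0 ∉ insert p1 (Finset.image (fun q : Fin k => e (q, ch q)) Finset.univ) := by
    intro ch; simp [he0, hp]
  have hcoc : ∀ ch : Fin k → Fin 2, _ := fun ch => cocycle π (gfun h) (k + 2)
    (fun B hB => gfun_cocycle h B (by simp [hB])) Φ hloc hΦ _
    (by rw [Finset.card_insert_of_notMem (m01 ch), Finset.card_insert_of_notMem (m1 ch),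
          Finset.card_image_of_injective _ (hes ch)]; simp) _ (hacc ch)
  have hterm : ∀ (ch : Fin k → Fin 2) (p : Fin N), (∀ q, e q ≠ p) → π p 0 = h (none, 0) →
      Acc (R π (insert p (Finset.image (fun q : Fin k => e (q, ch q)) Finset.univ)))
        (fun _ => 0) →
      Φ (insert p (Finset.image (fun q : Fin k => e (q, ch q)) Finset.univ)) (fun _ => 0)
        = sgn ch := by
    intro ch p hpe hp0 ha
    rw [(hΦ _ _ ha).1]
    · unfold gfun sgn
      rw [Fintype.prod_option]
      have f2 : ∀ s : Fin 2, s = 0 ∨ s = 1 := by decide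
      simp only [Finset.image_insert, Finset.image_image, Function.comp_def, hp0, hs,
        Finset.mem_insert, Finset.mem_image, Finset.mem_univ, true_and,
        EmbeddingLike.apply_eq_iff_eq, Prod.mk.injEq]
      simp only [reduceCtorEq, Option.some.injEq, false_and, false_or, exists_eq_left,
        and_false, exists_false, true_and]
      simp only [one_ne_zero, true_or, if_true, or_false, if_false, sub_zero, one_mul]
      apply Finset.prod_congr rfl
      intro q _
      rcases f2 (ch q) with hq | hq <;> simp [hq]
    · rw [Finset.eq_empty_iff_forall_notMem]
      intro i hi
      simp only [conf, Finset.mem_filter, Finset.mem_insert, Finset.mem_image, Finset.mem_univ,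
        true_and] at hi
      obtain ⟨hi, j, hj, hne, heq⟩ := hi
      rcases hi with rfl | ⟨q, rfl⟩ <;> rcases hj with rfl | ⟨q', rfl⟩
      · exact hne rfl
      · rw [hp0, hs] at heq; simp at heq
      · rw [hp0, hs] at heq; simp at heq
      · rw [hs, hs] at heq
        simp only [EmbeddingLike.apply_eq_iff_eq, Prod.mk.injEq, Option.some.injEq] at heq
        exact hne (by rw [heq.1])
  have key : ∀ ch : Fin k → Fin 2, 2 + ∑ q, sgn ch * Φ ((insert p0 (insert p1
      (Finset.image (fun q : Fin k => e (q, ch q)) Finset.univ))).erase (e (q, ch q)))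
        (fun _ => 0) = 0 := by
    intro ch
    have := hcoc ch
    rw [Finset.sum_insert (m01 ch), Finset.sum_insert (m1 ch),
      Finset.sum_image (fun _ _ _ _ hh => hes ch hh), Finset.erase_insert (m01 ch),
      Finset.erase_insert_of_ne hp, Finset.erase_insert (m1 ch),
      hterm ch p1 he1 h1 (Subrelation.accessible
        (fun hh => R_mono π (Finset.subset_insert _ _) _ _ hh) (hacc ch)),
      hterm ch p0 he0 h0 (Subrelation.accessible
        (fun hh => R_mono π (Finset.insert_subset_insert _ (Finset.subset_insert _ _)) _ _ hh)
          (hacc ch))] at this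
    rw [← Finset.mul_sum]
    linear_combination sgn ch * this - 2 * sgn_mul_self ch
  have tot := Finset.sum_eq_zero (s := Finset.univ) (fun ch _ => key ch)
  rw [Finset.sum_add_distrib, Finset.sum_comm, Finset.sum_eq_zero (s := Finset.univ)
    (f := fun q => ∑ _ch, _)] at tot
  · simp at tot
  · intro q _
    refine Finset.sum_involution (fun ch _ => Function.update ch q (ch q + 1)) ?_ ?_ ?_ ?_
    · intro ch _
      have : (insert p0 (insert p1 (Finset.image
          (fun q' : Fin k => e (q', Function.update ch q (ch q + 1) q')) Finset.univ))).erase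
            (e (q, Function.update ch q (ch q + 1) q)) = (insert p0 (insert p1
          (Finset.image (fun q : Fin k => e (q, ch q)) Finset.univ))).erase (e (q, ch q)) := by
        have gen : ∀ ch : Fin k → Fin 2, (insert p0 (insert p1
          (Finset.image (fun q : Fin k => e (q, ch q)) Finset.univ))).erase (e (q, ch q)) =
          insert p0 (insert p1
            (Finset.image (fun q : Fin k => e (q, ch q)) (Finset.univ.erase q))) := by
          intro ch
          rw [Finset.erase_insert_of_ne (he0 _).symm, Finset.erase_insert_of_ne (he1 _).symm,
            Finset.image_erase (hes ch)]
        rw [gen, gen]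
        congr 2
        apply Finset.image_congr
        intro x hx
        have : x ≠ q := Finset.ne_of_mem_erase hx
        simp [this]
      rw [this, sgn_update]
      ring
    · intro ch _ _ heq
      have := congrFun heq q
      simp at this
    · intro ch _; simp
    · intro ch _
      have : ∀ s : Fin 2, s + 1 + 1 = s := by decide
      simp [this]

theorem exists_chain {α : Type} (r : α → α → Prop) (a : α) (ha : ¬ Acc r a) :
    ∃ f : ℕ → α, f 0 = a ∧ ∀ n, r (f (n + 1)) (f n) := by
  have hstep : ∀ x : {x // ¬ Acc r x}, ∃ y : {x // ¬ Acc r x}, r y.1 x.1 := by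
    rintro ⟨x, hx⟩
    by_contra hcon
    push Not at hcon
    exact hx ⟨x, fun y hy => by
      by_contra hy'
      exact hcon ⟨y, hy'⟩ hy⟩
  choose nx hnx using hstep
  refine ⟨fun n => ((nx^[n]) ⟨a, ha⟩).1, rfl, fun n => ?_⟩
  simp only [Function.iterate_succ_apply']
  exact hnx _

end MusicalChairs

/-- With `N = 2n-2` words over `2n-2` chairs whose first letters are all distinct except
that the first two coincide, for every partition of the remaining `2n-4` words into
`n-2` pairs (encoded by an injection `e : Fin (n-2) × Fin 2 → Fin (2n-2)` whose range
consists of the indices `≥ 2`), one can pick one word from each pair so that the picked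
words together with the first two admit an infinite run starting from position `0` on
every word. -/
theorem stmt_9 (n : ℕ) (hn : 2 ≤ n) (π : Fin (2 * n - 2) → ℕ → Fin (2 * n - 2))
    (hco : π ⟨0, by omega⟩ 0 = π ⟨1, by omega⟩ 0)
    (hinj : ∀ i j : Fin (2 * n - 2), (i : ℕ) < (j : ℕ) →
      ¬((i : ℕ) = 0 ∧ (j : ℕ) = 1) → π i 0 ≠ π j 0)
    (e : Fin (n - 2) × Fin 2 → Fin (2 * n - 2))
    (he : Function.Injective e) (he2 : ∀ q, 2 ≤ (e q : ℕ)) :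
    ∃ choice : Fin (n - 2) → Fin 2,
      ∃ f : ℕ → (Fin (2 * n - 2) → ℕ),
        f 0 = (fun _ => 0) ∧
        ∀ t, SubStep π
          (insert (⟨0, by omega⟩ : Fin (2 * n - 2))
            (insert (⟨1, by omega⟩ : Fin (2 * n - 2))
              (Finset.image (fun q : Fin (n - 2) => e (q, choice q)) Finset.univ)))
          (f t) (f (t + 1)) := by
  by_contra hcon
  push Not at hcon
  have hv : ∀ q q' : Fin (2 * n - 2), π q 0 = π q' 0 →
      q = q' ∨ ((q : ℕ) < 2 ∧ (q' : ℕ) < 2) := by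
    intro q q' h
    rcases lt_trichotomy (q : ℕ) (q' : ℕ) with hlt | heq | hlt
    · by_cases h2 : (q : ℕ) = 0 ∧ (q' : ℕ) = 1
      · right; omega
      · exact absurd h (hinj q q' hlt h2)
    · left; exact Fin.ext heq
    · by_cases h2 : (q' : ℕ) = 0 ∧ (q : ℕ) = 1
      · right; omega
      · exact absurd h.symm (hinj q' q hlt h2)
  have hw : ∃ w : Fin (2 * n - 2), ∀ i, π i 0 ≠ w := by
    by_contra hno
    push Not at hno
    have hsurj : Function.Surjective (fun i => π i 0) := hno
    have hi : Function.Injective (fun i => π i 0) := Finite.injective_iff_surjective.2 hsurj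
    have := hi hco
    simp at this
  obtain ⟨w, hw⟩ := hw
  let hf : Option (Fin (n - 2)) × Fin 2 → Fin (2 * n - 2) := fun x =>
    match x with
    | (none, s) => if s = 0 then π ⟨0, by omega⟩ 0 else w
    | (some q, s) => π (e (q, s)) 0
  have hfinj : Function.Injective hf := by
    have f2 : ∀ s : Fin 2, s = 0 ∨ s = 1 := by decide
    rintro ⟨_ | q, s⟩ ⟨_ | q', s'⟩ hh
    · rcases f2 s with rfl | rfl <;> rcases f2 s' with rfl | rfl <;> simp [hf] at hh ⊢
      · exact hw _ hh
      · exact hw _ hh.symm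
    · exfalso
      have h2 := he2 (q', s')
      rcases f2 s with rfl | rfl <;> simp [hf] at hh
      · rcases hv _ _ hh with h3 | h3
        · rw [← h3] at h2; simp at h2
        · omega
      · exact hw _ hh.symm
    · exfalso
      have h2 := he2 (q, s)
      rcases f2 s' with rfl | rfl <;> simp [hf] at hh
      · rcases hv _ _ hh with h3 | h3
        · rw [h3] at h2; simp at h2
        · omega
      · exact hw _ hh
    · have h2 := he2 (q, s)
      rcases hv _ _ hh with h3 | h3
      · have := he h3
        simp only [Prod.mk.injEq] at this ⊢
        exact ⟨by rw [this.1], this.2⟩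
      · omega
  have hfbij : Function.Bijective hf := by
    rw [Fintype.bijective_iff_injective_and_card]
    refine ⟨hfinj, ?_⟩
    simp
    omega
  refine MusicalChairs.final π ⟨0, by omega⟩ ⟨1, by omega⟩ (by simp) e he
    (fun q hq => ?_) (fun q hq => ?_) (Equiv.ofBijective hf hfbij) (by simp [hf])
    (by simp [hf, hco]) (fun q s => by simp [hf]) (fun ch => ?_)
  · have := he2 q; rw [hq] at this; simp at this
  · have := he2 q; rw [hq] at this; simp at this
  · by_contra hna
    obtain ⟨f, hf0, hfs⟩ := MusicalChairs.exists_chain _ _ hna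
    obtain ⟨t, ht⟩ := hcon ch f hf0
    exact ht (hfs t)
end
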